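/- arXiv:0910.2318 — 3 statements merged into one kernel-verified Lean document; each statement's English description precedes it below -/
import Mathlib

section
/- Let X be a Polish space and let I be a Π¹₁ on Σ¹₁ σ-ideal on X generated by closed sets. Then for every analytic set A ⊆ X × X, either A ∈ I ⊗ I, or A contains a Gδ set G ⊆ A with G ∉ I ⊗ I. -/
open Set

/-- A σ-ideal: closed under subsets and countable unions. -/
def SigmaIdeal {X : Type*} (I : Set (Set X)) : Prop :=
  (∀ A B : Set X, A ⊆ B → B ∈ I → A ∈ I) ∧
  ∀ f : ℕ → Set X, (∀ n, f n ∈ I) → (⋃ n, f n) ∈ I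

/-- `I` is generated by closed sets: every member of `I` is contained in a countable
union of closed sets belonging to `I`. -/
def GeneratedByClosedSets {X : Type*} [TopologicalSpace X] (I : Set (Set X)) : Prop :=
  ∀ A ∈ I, ∃ f : ℕ → Set X, (∀ n, IsClosed (f n) ∧ f n ∈ I) ∧ A ⊆ ⋃ n, f n

/-- `A` is `I`-perfect: nonempty, and for every open `U` the set `A ∩ U` is empty or
`I`-positive. -/
def IdealPerfect {X : Type*} [TopologicalSpace X] (I : Set (Set X)) (A : Set X) : Prop :=
  A.Nonempty ∧ ∀ U : Set X, IsOpen U → A ∩ U = ∅ ∨ A ∩ U ∉ I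

/-- A family of sets is Π¹₁ on Σ¹₁ if for every analytic `L ⊆ ω^ω × X` the set of
parameters `t` whose section `L_t` belongs to the family is coanalytic. -/
def Pi11OnSigma11 {X : Type*} [TopologicalSpace X] (I : Set (Set X)) : Prop :=
  ∀ L : Set ((ℕ → ℕ) × X), MeasureTheory.AnalyticSet L →
    MeasureTheory.AnalyticSet {t : ℕ → ℕ | {x : X | (t, x) ∈ L} ∈ I}ᶜ

/-- The Fubini product of two σ-ideals. -/
def FubiniProd {X Y : Type*} (I : Set (Set X)) (J : Set (Set Y)) : Set (Set (X × Y)) :=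
  {A | {x : X | {y : Y | (x, y) ∈ A} ∉ J} ∈ I}


/-- The `G_δ` set coded by `c` relative to a sequence `W` of open sets. -/
def codedSet {X : Type*} (W : ℕ → Set X) (c : ℕ → ℕ) : Set X :=
  ⋂ n, ⋃ m, W (c (Nat.pair n m))

/-- `c` codes a scheme of boxes `Q i ×ˢ W i` meeting `F`, which determines a selection
of `F` over `codedSet W c`. -/
structure IsSelectionScheme {Z X : Type*} (Q : ℕ → Set Z) (W : ℕ → Set X)
    (small : ℕ → ℕ → Prop) (F : Set (Z × X)) (c : ℕ → ℕ) : Prop where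
  small : ∀ n m, small n (c (Nat.pair n m))
  coherent : ∀ k l, (W (c k) ∩ W (c l)).Nonempty → (Q (c k) ∩ Q (c l)).Nonempty
  meets : ∀ k, ((Q (c k) ×ˢ W (c k)) ∩ F).Nonempty

/-- The box with index `i` has diameter at most `2⁻ⁿ`. -/
def SmallBox {Z X : Type*} [MetricSpace Z] [MetricSpace X] (Q : ℕ → Set Z) (W : ℕ → Set X)
    (n i : ℕ) : Prop :=
  ∀ p ∈ Q i ×ˢ W i, ∀ q ∈ Q i ×ˢ W i, dist p q ≤ (1 / 2 : ℝ) ^ n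

theorem isGδ_codedSet {X : Type*} [TopologicalSpace X] {W : ℕ → Set X}
    (hW : ∀ i, IsOpen (W i)) (c : ℕ → ℕ) : IsGδ (codedSet W c) :=
  IsGδ.iInter_of_isOpen fun _ => isOpen_iUnion fun _ => hW _

theorem SmallBox.dist_fst_le {Z X : Type*} [MetricSpace Z] [MetricSpace X] {Q : ℕ → Set Z}
    {W : ℕ → Set X} {n i : ℕ} (h : SmallBox Q W n i) (hW : (W i).Nonempty) {z z' : Z}
    (hz : z ∈ Q i) (hz' : z' ∈ Q i) : dist z z' ≤ (1 / 2 : ℝ) ^ n := by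
  obtain ⟨y, hy⟩ := hW
  exact (le_max_left _ _).trans (h (z, y) ⟨hz, hy⟩ (z', y) ⟨hz', hy⟩)

theorem SmallBox.dist_snd_le {Z X : Type*} [MetricSpace Z] [MetricSpace X] {Q : ℕ → Set Z}
    {W : ℕ → Set X} {n i : ℕ} (h : SmallBox Q W n i) (hQ : (Q i).Nonempty) {y y' : X}
    (hy : y ∈ W i) (hy' : y' ∈ W i) : dist y y' ≤ (1 / 2 : ℝ) ^ n := by
  obtain ⟨z, hz⟩ := hQ
  exact (le_max_right _ _).trans (h (z, y) ⟨hz, hy⟩ (z, y') ⟨hz, hy'⟩)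

theorem tendsto_half_pow :
    Filter.Tendsto (fun n : ℕ => (1 / 2 : ℝ) ^ n) Filter.atTop (nhds 0) :=
  tendsto_pow_atTop_nhds_zero_of_lt_one (by norm_num) (by norm_num)

/-- A selection scheme for a closed set `F` yields a continuous selection of `F`. -/
theorem IsSelectionScheme.exists_continuousOn {Z X : Type*} [MetricSpace Z] [CompleteSpace Z]
    [MetricSpace X] {Q : ℕ → Set Z} {W : ℕ → Set X} (hW : ∀ i, IsOpen (W i))
    {F : Set (Z × X)} (hF : IsClosed F) {c : ℕ → ℕ}
    (hc : IsSelectionScheme Q W (SmallBox Q W) F c) :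
    ∃ h : X → Z, ContinuousOn h (codedSet W c) ∧ ∀ y ∈ codedSet W c, (h y, y) ∈ F := by
  have hsmall : ∀ n m n' m', (W (c (Nat.pair n m)) ∩ W (c (Nat.pair n' m'))).Nonempty →
      ∀ q ∈ Q (c (Nat.pair n m)), ∀ q' ∈ Q (c (Nat.pair n' m')),
        dist q q' ≤ (1 / 2 : ℝ) ^ n + (1 / 2 : ℝ) ^ n' := by
    intro n m n' m' hne q hq q' hq'
    obtain ⟨a, ha, ha'⟩ := hc.coherent _ _ hne
    exact (dist_triangle q a q').trans (add_le_add
      ((hc.small n m).dist_fst_le hne.left hq ha)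
      ((hc.small n' m').dist_fst_le hne.right ha' hq'))
  have key : ∀ y ∈ codedSet W c, ∃ z : Z, (z, y) ∈ F ∧ ∀ n m, y ∈ W (c (Nat.pair n m)) →
      ∀ q ∈ Q (c (Nat.pair n m)), dist q z ≤ (1 / 2 : ℝ) ^ n := by
    intro y hy
    simp only [codedSet, mem_iInter, mem_iUnion] at hy
    choose m hm using hy
    choose p hp hpF using fun n => hc.meets (Nat.pair n (m n))
    have hcauchy : CauchySeq fun n => (p n).1 := by
      refine cauchySeq_of_le_tendsto_0 (fun n => 2 * (1 / 2 : ℝ) ^ n) ?_ ?_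
      · intro n k N hn hk
        refine (hsmall n (m n) k (m k) ⟨y, hm n, hm k⟩ _ (hp n).1 _ (hp k).1).trans ?_
        have h1 : (1 / 2 : ℝ) ^ n ≤ (1 / 2 : ℝ) ^ N :=
          pow_le_pow_of_le_one (by norm_num) (by norm_num) hn
        have h2 : (1 / 2 : ℝ) ^ k ≤ (1 / 2 : ℝ) ^ N :=
          pow_le_pow_of_le_one (by norm_num) (by norm_num) hk
        linarith
      · simpa using tendsto_half_pow.const_mul 2
    obtain ⟨z, hz⟩ := cauchySeq_tendsto_of_complete hcauchy
    have hy' : Filter.Tendsto (fun n => (p n).2) Filter.atTop (nhds y) := by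
      rw [tendsto_iff_dist_tendsto_zero]
      refine squeeze_zero (fun _ => dist_nonneg) (fun n => ?_) tendsto_half_pow
      exact (hc.small n (m n)).dist_snd_le ⟨_, (hp n).1⟩ (hp n).2 (hm n)
    refine ⟨z, hF.mem_of_tendsto (hz.prodMk_nhds hy') (Filter.Eventually.of_forall hpF), ?_⟩
    intro n k hk q hq
    have h1 : Filter.Tendsto (fun i => dist q (p i).1) Filter.atTop (nhds (dist q z)) :=
      tendsto_const_nhds.dist hz
    have h2 : Filter.Tendsto (fun i => (1 / 2 : ℝ) ^ n + (1 / 2 : ℝ) ^ i) Filter.atTop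
        (nhds ((1 / 2 : ℝ) ^ n)) := by
      simpa using tendsto_half_pow.const_add ((1 / 2 : ℝ) ^ n)
    exact le_of_tendsto_of_tendsto' h1 h2 fun i =>
      hsmall n k i (m i) ⟨y, hk, hm i⟩ q hq _ (hp i).1
  rcases (codedSet W c).eq_empty_or_nonempty with he | ⟨y₀, hy₀⟩
  · rcases isEmpty_or_nonempty X with hX | ⟨⟨x⟩⟩
    · exact ⟨fun x => isEmptyElim x, by simp [he], by simp [he]⟩
    · obtain ⟨p, hp⟩ := hc.meets 0
      exact ⟨fun _ => p.1, by simp [he], by simp [he]⟩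
  obtain ⟨z₀, -⟩ := key y₀ hy₀
  have : Nonempty Z := ⟨z₀⟩
  choose! h hhF hh using key
  refine ⟨h, ?_, hhF⟩
  intro y hy
  rw [Metric.continuousWithinAt_iff']
  intro ε hε
  obtain ⟨n, hn⟩ := exists_pow_lt_of_lt_one (half_pos hε) (by norm_num : (1 / 2 : ℝ) < 1)
  obtain ⟨m, hm⟩ := mem_iUnion.1 (mem_iInter.1 hy n)
  filter_upwards [self_mem_nhdsWithin, mem_nhdsWithin_of_mem_nhds ((hW _).mem_nhds hm)]
    with y' hy' hy'm
  obtain ⟨p, hp, -⟩ := hc.meets (Nat.pair n m)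
  have h1 := hh y hy n m hm p.1 hp.1
  have h2 := hh y' hy' n m hy'm p.1 hp.1
  rw [dist_comm] at h2
  linarith [dist_triangle (h y') p.1 (h y)]


/-- The boxes `Q i ×ˢ W i` form a basis of the product topology, in which second factors can be
shrunk while keeping the first factor. -/
structure IsBoxBasis {Z X : Type*} [TopologicalSpace Z] [TopologicalSpace X]
    (Q : ℕ → Set Z) (W : ℕ → Set X) : Prop where
  isOpen_fst : ∀ i, IsOpen (Q i)
  isOpen_snd : ∀ i, IsOpen (W i)
  exists_subset : ∀ O : Set (Z × X), IsOpen O → ∀ p ∈ O, ∃ i, p ∈ Q i ×ˢ W i ∧ Q i ×ˢ W i ⊆ O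
  exists_snd_subset : ∀ i, ∀ V : Set X, IsOpen V → ∀ y ∈ V, ∃ j, Q j = Q i ∧ y ∈ W j ∧ W j ⊆ V

theorem exists_nat_basis (X : Type*) [TopologicalSpace X] [SecondCountableTopology X] :
    ∃ b : ℕ → Set X, (∀ i, IsOpen (b i)) ∧
      ∀ V : Set X, IsOpen V → ∀ y ∈ V, ∃ i, y ∈ b i ∧ b i ⊆ V := by
  obtain ⟨B, hBc, -, hB⟩ := TopologicalSpace.exists_countable_basis X
  obtain ⟨b, hb⟩ := (hBc.insert univ).exists_eq_range (insert_nonempty _ _)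
  refine ⟨b, fun i => ?_, fun V hV y hy => ?_⟩
  · have : b i ∈ insert univ B := hb ▸ mem_range_self i
    rcases this with h | h
    · exact h ▸ isOpen_univ
    · exact hB.isOpen h
  · obtain ⟨v, hv, hyv, hvV⟩ := hB.exists_subset_of_mem_open hy hV
    have : v ∈ range b := hb ▸ mem_insert_of_mem _ hv
    obtain ⟨i, rfl⟩ := this
    exact ⟨i, hyv, hvV⟩

theorem exists_isBoxBasis (Z X : Type*) [TopologicalSpace Z] [SecondCountableTopology Z]
    [TopologicalSpace X] [SecondCountableTopology X] :
    ∃ (Q : ℕ → Set Z) (W : ℕ → Set X), IsBoxBasis Q W := by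
  obtain ⟨a, hao, ha⟩ := exists_nat_basis Z
  obtain ⟨b, hbo, hb⟩ := exists_nat_basis X
  refine ⟨fun i => a i.unpair.1, fun i => b i.unpair.2, fun _ => hao _, fun _ => hbo _, ?_, ?_⟩
  · rintro O hO ⟨z, y⟩ hp
    obtain ⟨u, v, hu, hv, hz, hy, huv⟩ := isOpen_prod_iff.1 hO z y hp
    obtain ⟨i, hi, hiu⟩ := ha u hu z hz
    obtain ⟨j, hj, hjv⟩ := hb v hv y hy
    exact ⟨Nat.pair i j, by simpa using ⟨hi, hj⟩,
      by simpa using (prod_mono hiu hjv).trans huv⟩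
  · intro i V hV y hy
    obtain ⟨j, hj, hjv⟩ := hb V hV y hy
    exact ⟨Nat.pair i.unpair.1 j, by simp, by simpa using hj, by simpa using hjv⟩

/-- Levels `L n` of a tree of boxes meeting `F`, disjoint on `C` within each level. -/
structure IsBoxTree {Z X : Type*} [MetricSpace Z] [MetricSpace X] (Q : ℕ → Set Z)
    (W : ℕ → Set X) (F : Set (Z × X)) (C : Set X) (L : ℕ → Set ℕ) : Prop where
  meets : ∀ n, ∀ j ∈ L n, ((Q j ×ˢ W j) ∩ F).Nonempty
  parent : ∀ n, ∀ j ∈ L (n + 1), ∃ i ∈ L n, Q j ⊆ Q i ∧ W j ⊆ W i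
  small : ∀ n, ∀ j ∈ L (n + 1), SmallBox Q W n j
  disjoint : ∀ n, ∀ i ∈ L n, ∀ j ∈ L n, (W i ∩ W j ∩ C).Nonempty → i = j

theorem exists_maximal_disjoint {X : Type*} (E : ℕ → Set X) (T : Set ℕ)
    (hT : ∀ t ∈ T, (E t).Nonempty) :
    ∃ S ⊆ T, (∀ s ∈ S, ∀ t ∈ S, (E s ∩ E t).Nonempty → s = t) ∧
      ∀ t ∈ T, ∃ s ∈ S, (E s ∩ E t).Nonempty := by
  obtain ⟨S, hS⟩ := zorn_subset
    {S : Set ℕ | S ⊆ T ∧ ∀ s ∈ S, ∀ t ∈ S, (E s ∩ E t).Nonempty → s = t} (by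
      intro c hc hchain
      refine ⟨⋃₀ c, ⟨sUnion_subset fun s hs => (hc hs).1, ?_⟩, fun s hs => subset_sUnion_of_mem hs⟩
      rintro s ⟨A, hA, hsA⟩ t ⟨B, hB, htB⟩ hne
      rcases hchain.total hA hB with h | h
      · exact (hc hB).2 s (h hsA) t htB hne
      · exact (hc hA).2 s hsA t (h htB) hne)
  refine ⟨S, hS.prop.1, hS.prop.2, fun t ht => ?_⟩
  by_contra! hcon
  have htS : t ∈ S := by
    refine hS.le_of_ge (y := insert t S) ⟨insert_subset ht hS.prop.1, ?_⟩ (subset_insert _ _)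
      (mem_insert _ _)
    rintro s (rfl | hs) u (rfl | hu) hne
    · rfl
    · rw [inter_comm, hcon u hu] at hne
      exact absurd hne not_nonempty_empty
    · rw [hcon s hs] at hne
      exact absurd hne not_nonempty_empty
    · exact hS.prop.2 s hs u hu hne
  exact not_nonempty_iff_eq_empty.2 (by simpa using hcon t htS) (hT t ht)

theorem exists_isBoxTree {Z X : Type*} [MetricSpace Z] [MetricSpace X] {Q : ℕ → Set Z}
    {W : ℕ → Set X} {F : Set (Z × X)} {C : Set X} {r : ℕ} (hr : ((Q r ×ˢ W r) ∩ F).Nonempty)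
    (T : ℕ → ℕ → Set ℕ)
    (hT : ∀ n i, ∀ j ∈ T n i, ((Q j ×ˢ W j) ∩ F).Nonempty ∧ Q j ⊆ Q i ∧ W j ⊆ W i ∧
      SmallBox Q W n j ∧ (W j ∩ C).Nonempty) :
    ∃ L : ℕ → Set ℕ, L 0 = {r} ∧ IsBoxTree Q W F C L ∧
      (∀ n, ∀ j ∈ L (n + 1), ∃ i ∈ L n, j ∈ T n i) ∧
      ∀ n, ∀ i ∈ L n, ∀ j ∈ T n i, ∃ s ∈ L (n + 1), s ∈ T n i ∧ (W s ∩ W j ∩ C).Nonempty := by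
  choose S hST hSd hSm using fun n i => exists_maximal_disjoint (fun j => W j ∩ C) (T n i)
    fun j hj => (hT n i j hj).2.2.2.2
  let L : ℕ → Set ℕ := fun n => Nat.rec {r} (fun n A => ⋃ i ∈ A, S n i) n
  have hL0 : L 0 = {r} := rfl
  have hL : ∀ n j, j ∈ L (n + 1) ↔ ∃ i ∈ L n, j ∈ S n i := by
    intro n j
    change j ∈ ⋃ i ∈ L n, S n i ↔ _
    simp
  have hinter : ∀ i j, W i ∩ C ∩ (W j ∩ C) = W i ∩ W j ∩ C := fun i j =>
    (inter_inter_distrib_right _ _ _).symm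
  refine ⟨L, hL0, ⟨?_, ?_, ?_, ?_⟩, ?_, ?_⟩
  · rintro (_ | n) j hj
    · rw [hL0, mem_singleton_iff] at hj
      exact hj ▸ hr
    · obtain ⟨i, -, h⟩ := (hL n j).1 hj
      exact (hT n i j (hST n i h)).1
  · intro n j hj
    obtain ⟨i, hi, h⟩ := (hL n j).1 hj
    exact ⟨i, hi, (hT n i j (hST n i h)).2.1, (hT n i j (hST n i h)).2.2.1⟩
  · intro n j hj
    obtain ⟨i, hi, h⟩ := (hL n j).1 hj
    exact (hT n i j (hST n i h)).2.2.2.1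
  · intro n
    induction n with
    | zero =>
      intro i hi j hj _
      rw [hL0, mem_singleton_iff] at hi hj
      rw [hi, hj]
    | succ n ih =>
      intro i hi j hj hne
      obtain ⟨i', hi', hii⟩ := (hL n i).1 hi
      obtain ⟨j', hj', hjj⟩ := (hL n j).1 hj
      have h1 := (hT n i' i (hST n i' hii)).2.2.1
      have h2 := (hT n j' j (hST n j' hjj)).2.2.1
      obtain rfl := ih i' hi' j' hj'
        (hne.mono (inter_subset_inter_left _ (inter_subset_inter h1 h2)))
      exact hSd n i' i hii j hjj (by rwa [hinter])
  · intro n j hj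
    obtain ⟨i, hi, h⟩ := (hL n j).1 hj
    exact ⟨i, hi, hST n i h⟩
  · intro n i hi j hj
    obtain ⟨s, hs, hne⟩ := hSm n i j hj
    exact ⟨s, (hL n s).2 ⟨i, hi, hs⟩, hST n i hs, by rwa [hinter] at hne⟩

namespace IsBoxTree

variable {Z X : Type*} [MetricSpace Z] [MetricSpace X] {Q : ℕ → Set Z} {W : ℕ → Set X}
  {F : Set (Z × X)} {C : Set X} {L : ℕ → Set ℕ}

theorem ancestor (h : IsBoxTree Q W F C L) (n k : ℕ) :
    ∀ j ∈ L (n + k), ∃ i ∈ L n, Q j ⊆ Q i ∧ W j ⊆ W i := by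
  induction k with
  | zero => exact fun j hj => ⟨j, hj, Subset.rfl, Subset.rfl⟩
  | succ k ih =>
    intro j hj
    obtain ⟨i, hi, h1, h2⟩ := h.parent (n + k) j hj
    obtain ⟨i', hi', h1', h2'⟩ := ih i hi
    exact ⟨i', hi', h1.trans h1', h2.trans h2'⟩

theorem comparable_of_le (h : IsBoxTree Q W F C L) {n m : ℕ} (hnm : n ≤ m) {i j : ℕ}
    (hi : i ∈ L n) (hj : j ∈ L m) (hne : (W i ∩ W j ∩ C).Nonempty) : Q j ⊆ Q i ∧ W j ⊆ W i := by
  obtain ⟨k, rfl⟩ := Nat.exists_eq_add_of_le hnm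
  obtain ⟨i', hi', h1, h2⟩ := h.ancestor n k j hj
  obtain rfl := h.disjoint n i hi i' hi'
    (hne.mono (inter_subset_inter_left _ (inter_subset_inter_right _ h2)))
  exact ⟨h1, h2⟩

theorem coherent (h : IsBoxTree Q W F C L) {n m : ℕ} {i j : ℕ}
    (hi : i ∈ L n) (hj : j ∈ L m) (hne : (W i ∩ W j ∩ C).Nonempty) : (Q i ∩ Q j).Nonempty := by
  obtain ⟨p, ⟨hp, -⟩, -⟩ := h.meets n i hi
  obtain ⟨q, ⟨hq, -⟩, -⟩ := h.meets m j hj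
  rcases le_total n m with hnm | hnm
  · exact ⟨q.1, (h.comparable_of_le hnm hi hj hne).1 hq, hq⟩
  · rw [inter_comm (W i)] at hne
    exact ⟨p.1, hp, (h.comparable_of_le hnm hj hi hne).1 hp⟩

theorem exists_isSelectionScheme (h : IsBoxTree Q W F C L) (hb : IsBoxBasis Q W)
    (hne : (C ∩ ⋂ n, ⋃ j ∈ L n, W j).Nonempty) :
    ∃ c, IsSelectionScheme Q W (SmallBox Q W) F c ∧ C ∩ ⋂ n, ⋃ j ∈ L n, W j ⊆ codedSet W c := by
  let S : ℕ → Set ℕ := fun n => {k | ((Q k ×ˢ W k) ∩ F).Nonempty ∧ ∃ j ∈ L (n + 1),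
    Q k = Q j ∧ W k ⊆ W j ∧ ∃ y ∈ W j ∩ C, ∃ ρ > 0, Metric.ball y (2 * ρ) ∩ C ⊆ W j ∧
      W k ⊆ Metric.ball y ρ}
  have hS : ∀ n, ∀ y ∈ C ∩ ⋂ n, ⋃ j ∈ L n, W j, ∃ k ∈ S n, y ∈ W k := by
    rintro n y ⟨hyC, hy⟩
    simp only [mem_iInter, mem_iUnion, exists_prop] at hy
    obtain ⟨j, hj, hyj⟩ := hy (n + 1)
    obtain ⟨ε, hε, hball⟩ := Metric.isOpen_iff.1 (hb.isOpen_snd j) y hyj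
    obtain ⟨k, hk, hyk, hkV⟩ := hb.exists_snd_subset j (Metric.ball y (ε / 2))
      Metric.isOpen_ball y (Metric.mem_ball_self (half_pos hε))
    have hkj : W k ⊆ W j := hkV.trans ((Metric.ball_subset_ball (by linarith)).trans hball)
    refine ⟨k, ⟨?_, j, hj, hk, hkj, y, ⟨hyj, hyC⟩, ε / 2, half_pos hε, ?_, hkV⟩, hyk⟩
    · obtain ⟨δ, hδ, hδk⟩ := Metric.isOpen_iff.1 (hb.isOpen_snd k) y hyk
      obtain ⟨m, hm⟩ := exists_pow_lt_of_lt_one hδ (by norm_num : (1 / 2 : ℝ) < 1)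
      obtain ⟨i, hi, hyi⟩ := hy (n + m + 1)
      obtain ⟨h1, -⟩ := h.comparable_of_le (by omega) hj hi ⟨y, ⟨hyj, hyi⟩, hyC⟩
      obtain ⟨p, ⟨hp1, hp2⟩, hpF⟩ := h.meets _ i hi
      refine ⟨p, ⟨hk ▸ h1 hp1, hδk ?_⟩, hpF⟩
      refine ((h.small _ i hi).dist_snd_le ⟨_, hp1⟩ hp2 hyi).trans_lt (lt_of_le_of_lt ?_ hm)
      exact pow_le_pow_of_le_one (by norm_num) (by norm_num) (by omega)
    · rw [mul_div_cancel₀ _ two_ne_zero]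
      exact inter_subset_left.trans hball
  obtain ⟨y₀, hy₀⟩ := hne
  have hSne : ∀ n, (S n).Nonempty := fun n => let ⟨k, hk, _⟩ := hS n y₀ hy₀; ⟨k, hk⟩
  choose e he using fun n => (S n).to_countable.exists_eq_range (hSne n)
  have hmem : ∀ k : ℕ, e k.unpair.1 k.unpair.2 ∈ S k.unpair.1 := fun k => by
    rw [he]
    exact mem_range_self _
  refine ⟨fun k => e k.unpair.1 k.unpair.2, ⟨fun n m => ?_, ?_, fun k => (hmem k).1⟩, ?_⟩
  · obtain ⟨-, j, hj, hQ, hW, -⟩ := hmem (Nat.pair n m)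
    simp only [Nat.unpair_pair] at hj hQ hW ⊢
    have := h.small n j hj
    exact fun p hp q hq => this p ⟨hQ ▸ hp.1, hW hp.2⟩ q ⟨hQ ▸ hq.1, hW hq.2⟩
  · intro k l hkl
    obtain ⟨-, i, hi, hQi, hWi, y, hy, ρ, hρ, hyρ, hWρ⟩ := hmem k
    obtain ⟨-, j, hj, hQj, hWj, x, hx, σ, hσ, hxσ, hWσ⟩ := hmem l
    rw [hQi, hQj]
    refine h.coherent hi hj ?_
    obtain ⟨w, hwk, hwl⟩ := hkl
    have h1 := Metric.mem_ball.1 (hWρ hwk)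
    have h2 := Metric.mem_ball.1 (hWσ hwl)
    have h3 := dist_triangle_left x y w
    rcases le_total ρ σ with hle | hle
    · refine ⟨y, ⟨hy.1, hxσ ⟨?_, hy.2⟩⟩, hy.2⟩
      rw [Metric.mem_ball, dist_comm]
      linarith
    · refine ⟨x, ⟨hyρ ⟨?_, hx.2⟩, hx.1⟩, hx.2⟩
      rw [Metric.mem_ball]
      linarith
  · intro y hy
    refine mem_iInter.2 fun n => ?_
    obtain ⟨k, hk, hyk⟩ := hS n y hy
    rw [he] at hk
    obtain ⟨m, rfl⟩ := hk
    exact mem_iUnion.2 ⟨m, by simpa using hyk⟩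

end IsBoxTree


theorem SigmaIdeal.mono {X : Type*} {I : Set (Set X)} (hI : SigmaIdeal I) {A B : Set X}
    (h : A ⊆ B) (hB : B ∈ I) : A ∈ I :=
  hI.1 A B h hB

theorem SigmaIdeal.union {X : Type*} {I : Set (Set X)} (hI : SigmaIdeal I) {A B : Set X}
    (hA : A ∈ I) (hB : B ∈ I) : A ∪ B ∈ I := by
  refine hI.mono ?_ (hI.2 (fun n => if n = 0 then A else B) fun n => ?_)
  · rintro x (hx | hx)
    · exact mem_iUnion.2 ⟨0, by simpa using hx⟩
    · exact mem_iUnion.2 ⟨1, by simpa using hx⟩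
  · split_ifs <;> assumption

/-- The part of `F` left after removing all boxes over which the projection of `F` lies in `I`
has a projection that is everywhere `I`-positive. -/
theorem exists_everywhere_positive {Z X : Type*} [TopologicalSpace Z] [TopologicalSpace X]
    {Q : ℕ → Set Z} {W : ℕ → Set X} (hb : IsBoxBasis Q W) {I : Set (Set X)} (hI : SigmaIdeal I)
    (hI0 : ∅ ∈ I) {F : Set (Z × X)} (hpos : Prod.snd '' F ∉ I) :
    ∃ F' ⊆ F, F'.Nonempty ∧
      ∀ O : Set (Z × X), IsOpen O → (O ∩ F').Nonempty → Prod.snd '' (O ∩ F') ∉ I := by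
  classical
  let bad : Set ℕ := {i | Prod.snd '' ((Q i ×ˢ W i) ∩ F) ∈ I}
  let R : Set X := ⋃ i, if i ∈ bad then Prod.snd '' ((Q i ×ˢ W i) ∩ F) else ∅
  have hR : R ∈ I := hI.2 _ fun i => by
    split_ifs with h
    exacts [h, hI0]
  have hsub : ∀ p ∈ F, p ∈ ⋃ i ∈ bad, Q i ×ˢ W i → p.2 ∈ R := by
    intro p hp hpb
    obtain ⟨i, hi, hpi⟩ := mem_iUnion₂.1 hpb
    exact mem_iUnion.2 ⟨i, by rw [if_pos hi]; exact ⟨p, ⟨hpi, hp⟩, rfl⟩⟩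
  have hpart : ∀ O : Set (Z × X),
      Prod.snd '' (O ∩ F) ⊆ Prod.snd '' (O ∩ (F \ ⋃ i ∈ bad, Q i ×ˢ W i)) ∪ R := by
    rintro O _ ⟨p, ⟨hpO, hpF⟩, rfl⟩
    by_cases hpb : p ∈ ⋃ i ∈ bad, Q i ×ˢ W i
    · exact Or.inr (hsub p hpF hpb)
    · exact Or.inl ⟨p, ⟨hpO, hpF, hpb⟩, rfl⟩
  refine ⟨F \ ⋃ i ∈ bad, Q i ×ˢ W i, sdiff_subset, ?_, ?_⟩
  · by_contra hcon
    rw [not_nonempty_iff_eq_empty] at hcon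
    refine hpos (hI.mono ?_ hR)
    simpa [hcon] using hpart univ
  · rintro O hO ⟨p, hpO, hpF, hpb⟩ hOI
    obtain ⟨i, hpi, hiO⟩ := hb.exists_subset O hO p hpO
    refine hpb (mem_iUnion₂.2 ⟨i, ?_, hpi⟩)
    exact hI.mono ((hpart _).trans (union_subset_union_left _
      (image_mono (inter_subset_inter_left _ hiO)))) (hI.union hOI hR)

theorem IsBoxBasis.exists_smallBox {Z X : Type*} [MetricSpace Z] [MetricSpace X]
    {Q : ℕ → Set Z} {W : ℕ → Set X} (hb : IsBoxBasis Q W) (n : ℕ) {O : Set (Z × X)}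
    (hO : IsOpen O) {p : Z × X} (hp : p ∈ O) :
    ∃ i, p ∈ Q i ×ˢ W i ∧ Q i ×ˢ W i ⊆ O ∧ SmallBox Q W n i := by
  have hε : 0 < (1 / 2 : ℝ) ^ n / 2 := by positivity
  obtain ⟨i, hi, hiO⟩ := hb.exists_subset (O ∩ Metric.ball p ((1 / 2 : ℝ) ^ n / 2))
    (hO.inter Metric.isOpen_ball) p ⟨hp, Metric.mem_ball_self hε⟩
  refine ⟨i, hi, hiO.trans inter_subset_left, fun q hq q' hq' => ?_⟩
  have h1 := Metric.mem_ball.1 (hiO hq).2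
  have h2 := Metric.mem_ball.1 (hiO hq').2
  linarith [dist_triangle_right q q' p]

theorem prod_subset_prod_of_nonempty {Z X : Type*} {A A' : Set Z} {B B' : Set X}
    (hne : (A ×ˢ B).Nonempty) (h : A ×ˢ B ⊆ A' ×ˢ B') : A ⊆ A' ∧ B ⊆ B' := by
  rcases prod_subset_prod_iff.1 h with h | h | h
  · exact h
  · exact absurd hne (by simp [h])
  · exact absurd hne (by simp [h])

section Positive

variable {Z X : Type*} [MetricSpace Z] [MetricSpace X] {Q : ℕ → Set Z} {W : ℕ → Set X}
  {I : Set (Set X)} {F : Set (Z × X)}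

/-- If the closed nowhere dense subsets of the closure of some box projection all lie in `I`,
a box tree dense on that closure gives an `I`-positive coded set. -/
theorem exists_positive_scheme_of_nowhereDense (hb : IsBoxBasis Q W) (hI : SigmaIdeal I)
    (hI0 : ∅ ∈ I)
    (hF : ∀ O : Set (Z × X), IsOpen O → (O ∩ F).Nonempty → Prod.snd '' (O ∩ F) ∉ I)
    {r : ℕ} (hr : ((Q r ×ˢ W r) ∩ F).Nonempty)
    (hN : ∀ N ⊆ closure (Prod.snd '' ((Q r ×ˢ W r) ∩ F)), IsClosed N →
      (∀ V, IsOpen V → (V ∩ closure (Prod.snd '' ((Q r ×ˢ W r) ∩ F))).Nonempty →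
        ((V ∩ closure (Prod.snd '' ((Q r ×ˢ W r) ∩ F))) \ N).Nonempty) → N ∈ I) :
    ∃ c, IsSelectionScheme Q W (SmallBox Q W) F c ∧ codedSet W c ∉ I := by
  set P : ℕ → Set X := fun j => Prod.snd '' ((Q j ×ˢ W j) ∩ F) with hP
  have hPW : ∀ j, P j ⊆ W j := by
    rintro j _ ⟨p, ⟨hp, -⟩, rfl⟩
    exact hp.2
  have hPmono : ∀ {i j}, Q i ⊆ Q j → W i ⊆ W j → P i ⊆ P j := fun h1 h2 =>
    image_mono (inter_subset_inter_left _ (prod_mono h1 h2))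
  set C := closure (P r) with hC
  have hCI : C ∉ I := fun h => hF _ ((hb.isOpen_fst r).prod (hb.isOpen_snd r)) hr
    (hI.mono subset_closure h)
  let T : ℕ → ℕ → Set ℕ := fun n i => {j | Q j ⊆ Q i ∧ W j ⊆ W i ∧ SmallBox Q W n j ∧
    (W j ∩ C).Nonempty ∧ W j ∩ C ⊆ closure (P j) ∧ Q j ⊆ Q r ∧ W j ⊆ W r}
  have hmeet : ∀ {j}, (W j ∩ C).Nonempty → W j ∩ C ⊆ closure (P j) →
      ((Q j ×ˢ W j) ∩ F).Nonempty := by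
    intro j h1 h2
    have := (closure_nonempty_iff.1 (h1.mono h2))
    exact this.of_image
  obtain ⟨L, hL0, hL, hLT, hLm⟩ := exists_isBoxTree (C := C) hr T
    fun n i j hj => ⟨hmeet hj.2.2.2.1 hj.2.2.2.2.1, hj.1, hj.2.1, hj.2.2.1, hj.2.2.2.1⟩
  have hgood : ∀ n, ∀ i ∈ L n, W i ∩ C ⊆ closure (P i) ∧ Q i ⊆ Q r ∧ W i ⊆ W r := by
    rintro (_ | n) i hi
    · rw [hL0, mem_singleton_iff] at hi
      subst hi
      exact ⟨inter_subset_right, Subset.rfl, Subset.rfl⟩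
    · obtain ⟨i', -, h⟩ := hLT n i hi
      exact h.2.2.2.2
  have hrich : ∀ n, ∀ i ∈ L n, ∀ V, IsOpen V → (V ∩ W i ∩ C).Nonempty →
      ∃ j ∈ T n i, W j ⊆ V := by
    intro n i hi V hV hne
    obtain ⟨hi1, hi2, hi3⟩ := hgood n i hi
    have hVi : IsOpen (V ∩ W i) := hV.inter (hb.isOpen_snd i)
    obtain ⟨y, hy, hyC⟩ := hne
    obtain ⟨_, hyV, p, ⟨hpB, hpF⟩, rfl⟩ := mem_closure_iff.1 (hi1 ⟨hy.2, hyC⟩) _ hVi hy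
    have hO : IsOpen (Q i ×ˢ (V ∩ W i)) := (hb.isOpen_fst i).prod hVi
    obtain ⟨j, hjn, hjO, hjI⟩ : ∃ j, SmallBox Q W n j ∧ Q j ×ˢ W j ⊆ Q i ×ˢ (V ∩ W i) ∧
        P j ∉ I := by
      by_contra! hcon
      classical
      refine hF _ hO ⟨p, ⟨hpB.1, hyV⟩, hpF⟩ (hI.mono ?_ (hI.2
        (fun j => if SmallBox Q W n j ∧ Q j ×ˢ W j ⊆ Q i ×ˢ (V ∩ W i) then P j else ∅) ?_))
      · rintro _ ⟨q, ⟨hqO, hqF⟩, rfl⟩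
        obtain ⟨j, hqj, hjO, hjn⟩ := hb.exists_smallBox n hO hqO
        exact mem_iUnion.2 ⟨j, by rw [if_pos ⟨hjn, hjO⟩]; exact ⟨q, ⟨hqj, hqF⟩, rfl⟩⟩
      · intro j
        split_ifs with h
        exacts [hcon j h.1 h.2, hI0]
    have hPj : (P j).Nonempty := by
      by_contra h
      rw [not_nonempty_iff_eq_empty] at h
      exact hjI (h ▸ hI0)
    have hBj : (Q j ×ˢ W j).Nonempty := (hPj.of_image).mono inter_subset_left
    obtain ⟨hQj, hWj⟩ := prod_subset_prod_of_nonempty hBj hjO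
    have hPr : P j ⊆ P r := hPmono (hQj.trans hi2) ((hWj.trans inter_subset_right).trans hi3)
    obtain ⟨V', hV', hne', hV'sub⟩ : ∃ V', IsOpen V' ∧ (V' ∩ C).Nonempty ∧
        V' ∩ C ⊆ closure (P j) := by
      by_contra! hcon
      refine hjI (hI.mono subset_closure (hN _ (closure_mono hPr) isClosed_closure ?_))
      intro V' hV' hne'
      exact sdiff_nonempty.2 (hcon V' hV' hne')
    obtain ⟨x, hx⟩ := hne'
    obtain ⟨y', hy'V, hy'P⟩ := mem_closure_iff.1 (hV'sub hx) V' hV' hx.1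
    obtain ⟨k, hkQ, hyk, hkV⟩ := hb.exists_snd_subset j (V' ∩ W j)
      (hV'.inter (hb.isOpen_snd j)) y' ⟨hy'V, hPW j hy'P⟩
    have hkj : W k ⊆ W j := hkV.trans inter_subset_right
    refine ⟨k, ⟨hkQ ▸ hQj, (hkj.trans hWj).trans inter_subset_right, ?_,
      ⟨y', hyk, subset_closure (hPr hy'P)⟩, ?_, hkQ ▸ hQj.trans hi2,
      ((hkj.trans hWj).trans inter_subset_right).trans hi3⟩, (hkj.trans hWj).trans inter_subset_left⟩
    · exact fun p hp q hq => hjn p ⟨hkQ ▸ hp.1, hkj hp.2⟩ q ⟨hkQ ▸ hq.1, hkj hq.2⟩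
    · rintro w ⟨hwk, hwC⟩
      have hw := hV'sub ⟨(hkV hwk).1, hwC⟩
      rw [mem_closure_iff] at hw ⊢
      intro U hU hwU
      obtain ⟨_, ⟨huU, huk⟩, p, ⟨hpj, hpF⟩, rfl⟩ :=
        hw (U ∩ W k) (hU.inter (hb.isOpen_snd k)) ⟨hwU, hwk⟩
      exact ⟨_, huU, p, ⟨⟨hkQ ▸ hpj.1, huk⟩, hpF⟩, rfl⟩
  have hdense : ∀ n V, IsOpen V → (V ∩ C).Nonempty → (V ∩ C ∩ ⋃ i ∈ L n, W i).Nonempty := by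
    intro n
    induction n with
    | zero =>
      rintro V hV ⟨y, hyV, hyC⟩
      obtain ⟨x, hxV, hxP⟩ := mem_closure_iff.1 hyC V hV hyV
      exact ⟨x, ⟨hxV, subset_closure hxP⟩, mem_iUnion₂.2 ⟨r, by rw [hL0]; rfl, hPW r hxP⟩⟩
    | succ n ih =>
      intro V hV hne
      obtain ⟨y, ⟨hyV, hyC⟩, hyL⟩ := ih V hV hne
      obtain ⟨i, hi, hyi⟩ := mem_iUnion₂.1 hyL
      obtain ⟨j, hj, hjV⟩ := hrich n i hi V hV ⟨y, ⟨hyV, hyi⟩, hyC⟩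
      obtain ⟨s, hs, -, x, ⟨hxs, hxj⟩, hxC⟩ := hLm n i hi j hj
      exact ⟨x, ⟨hjV hxj, hxC⟩, mem_iUnion₂.2 ⟨s, hs, hxs⟩⟩
  have hG : C ∩ ⋂ n, ⋃ j ∈ L n, W j ∉ I := by
    intro hG
    refine hCI (hI.mono (B := (C ∩ ⋂ n, ⋃ j ∈ L n, W j) ∪ ⋃ n, C \ ⋃ j ∈ L n, W j) ?_
      (hI.union hG (hI.2 _ fun n => hN _ sdiff_subset ?_ ?_)))
    · rw [← sdiff_iInter, inter_union_sdiff]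
    · exact isClosed_closure.sdiff (isOpen_biUnion fun j _ => hb.isOpen_snd j)
    · intro V hV hne
      obtain ⟨x, hx, hxL⟩ := hdense n V hV hne
      exact ⟨x, hx, fun h => h.2 hxL⟩
  obtain ⟨c, hc, hcG⟩ := hL.exists_isSelectionScheme hb (by
    by_contra h
    rw [not_nonempty_iff_eq_empty] at h
    exact hG (h ▸ hI0))
  exact ⟨c, hc, fun h => hG (hI.mono hcG h)⟩

/-- If the closure of every box projection has an `I`-positive closed nowhere dense subset, a box
tree accumulating at such subsets gives an `I`-positive coded set. -/
theorem exists_positive_scheme_of_accumulation [CompleteSpace X] (hb : IsBoxBasis Q W)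
    (hI : SigmaIdeal I) (hgen : GeneratedByClosedSets I) {r : ℕ}
    (hr : ((Q r ×ˢ W r) ∩ F).Nonempty) (hI0 : ∅ ∈ I)
    (hN : ∀ i, ((Q i ×ˢ W i) ∩ F).Nonempty →
      ∃ N ⊆ closure (Prod.snd '' ((Q i ×ˢ W i) ∩ F)), IsClosed N ∧
      (∀ V, IsOpen V → (V ∩ closure (Prod.snd '' ((Q i ×ˢ W i) ∩ F))).Nonempty →
        ((V ∩ closure (Prod.snd '' ((Q i ×ˢ W i) ∩ F))) \ N).Nonempty) ∧ N ∉ I) :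
    ∃ c, IsSelectionScheme Q W (SmallBox Q W) F c ∧ codedSet W c ∉ I := by
  choose! N hNsub hNc hNd hNI using hN
  let T : ℕ → ℕ → Set ℕ := fun n i => {j | ((Q j ×ˢ W j) ∩ F).Nonempty ∧ Q j ⊆ Q i ∧
    closure (W j) ⊆ W i ∧ SmallBox Q W n j ∧
      ∀ w ∈ W j, ∀ w' ∈ W j, ∀ p ∈ N i, dist w w' ≤ dist w p}
  obtain ⟨L, hL0, hL, hLT, hLm⟩ := exists_isBoxTree (C := univ) hr T fun n i j hj =>
    ⟨hj.1, hj.2.1, subset_closure.trans hj.2.2.1, hj.2.2.2.1, by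
      obtain ⟨p, hp, -⟩ := hj.1
      exact ⟨p.2, hp.2, trivial⟩⟩
  have hacc : ∀ n, ∀ i ∈ L n, ∀ p ∈ N i, ∀ ε > 0,
      ∃ j ∈ L (n + 1), closure (W j) ⊆ W i ∧ W j ⊆ Metric.ball p ε := by
    intro n i hi p hp ε hε
    have hiF := hL.meets n i hi
    obtain ⟨y₀, ⟨hy₀, hy₀C⟩, hy₀N⟩ := hNd i hiF (Metric.ball p (ε / 2)) Metric.isOpen_ball
      ⟨p, Metric.mem_ball_self (half_pos hε), hNsub i hiF hp⟩
    obtain ⟨_, ⟨hyV, hyN⟩, q, ⟨hqB, hqF⟩, rfl⟩ := mem_closure_iff.1 hy₀C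
      (Metric.ball p (ε / 2) ∩ (N i)ᶜ) (Metric.isOpen_ball.inter (hNc i hiF).isOpen_compl)
      ⟨hy₀, hy₀N⟩
    obtain ⟨δ, hδ, hδN⟩ := Metric.isOpen_iff.1 (hNc i hiF).isOpen_compl q.2 hyN
    obtain ⟨ρ, hρ, hρW⟩ := Metric.nhds_basis_closedBall.mem_iff.1
      ((hb.isOpen_snd i).mem_nhds hqB.2)
    have hσ : 0 < min ρ (δ / 4) := lt_min hρ (by linarith)
    obtain ⟨j, hqj, hjO, hjn⟩ := hb.exists_smallBox n
      (O := Q i ×ˢ (Metric.ball p (ε / 2) ∩ Metric.ball q.2 (min ρ (δ / 4))))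
      ((hb.isOpen_fst i).prod (Metric.isOpen_ball.inter Metric.isOpen_ball))
      (p := q) ⟨hqB.1, hyV, Metric.mem_ball_self hσ⟩
    obtain ⟨hQj, hWj⟩ := prod_subset_prod_of_nonempty ⟨q, hqj⟩ hjO
    have hjT : j ∈ T n i := by
      refine ⟨⟨q, hqj, hqF⟩, hQj, ?_, hjn, ?_⟩
      · refine (closure_minimal ?_ Metric.isClosed_closedBall).trans hρW
        exact (hWj.trans inter_subset_right).trans ((Metric.ball_subset_ball
          (min_le_left _ _)).trans Metric.ball_subset_closedBall)
      · intro w hw w' hw' x hx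
        have h1 := (Metric.mem_ball.1 (hWj hw).2).trans_le (min_le_right _ _)
        have h2 := (Metric.mem_ball.1 (hWj hw').2).trans_le (min_le_right _ _)
        have h3 : δ ≤ dist x q.2 := by
          by_contra! h
          exact hδN (Metric.mem_ball.2 h) hx
        have h4 := dist_triangle_right w w' q.2
        have h5 := dist_triangle_left x q.2 w
        linarith
    obtain ⟨s, hs, hsT, x, ⟨hxs, hxj⟩, -⟩ := hLm n i hi j hjT
    refine ⟨s, hs, hsT.2.2.1, fun w hw => ?_⟩
    have h1 := hsT.2.2.2.2 x hxs w hw p hp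
    have h2 := Metric.mem_ball.1 (hWj hxj).1
    rw [Metric.mem_ball]
    linarith [dist_triangle_left w p x]
  have hG : univ ∩ ⋂ n, ⋃ j ∈ L n, W j ∉ I := by
    intro hG
    obtain ⟨K, hK, hGK⟩ := hgen _ hG
    have hstep : ∀ n i, i ∈ L n → ∃ j, j ∈ L (n + 1) ∧ closure (W j) ⊆ W i ∧ W j ∩ K n = ∅ := by
      intro n i hi
      have hnot : ¬ N i ⊆ K n := fun h => hNI i (hL.meets n i hi) (hI.mono h (hK n).2)
      obtain ⟨p, hpN, hpK⟩ := not_subset.1 hnot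
      obtain ⟨ε, hε, hεK⟩ := Metric.isOpen_iff.1 (hK n).1.isOpen_compl p hpK
      obtain ⟨j, hj, hji, hjp⟩ := hacc n i hi p hpN ε hε
      exact ⟨j, hj, hji, eq_empty_of_forall_notMem fun x hx => hεK (hjp hx.1) hx.2⟩
    choose! φ hφL hφW hφK using hstep
    let b : ℕ → ℕ := fun n => Nat.rec r φ n
    have hbs : ∀ n, b (n + 1) = φ n (b n) := fun _ => rfl
    have hbL : ∀ n, b n ∈ L n := by
      intro n
      induction n with
      | zero => rw [hL0]; rfl
      | succ n ih => rw [hbs]; exact hφL n _ ih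
    have hbW : ∀ n, closure (W (b (n + 1))) ⊆ W (b n) := fun n => by
      rw [hbs]
      exact hφW n _ (hbL n)
    have hanti : Antitone fun n => W (b n) :=
      antitone_nat_of_succ_le fun n => subset_closure.trans (hbW n)
    choose p hp _ using fun n => hL.meets n _ (hbL n)
    have hcauchy : CauchySeq fun n => (p (n + 1)).2 := by
      refine cauchySeq_of_le_tendsto_0 (fun n => (1 / 2 : ℝ) ^ n) ?_ tendsto_half_pow
      intro n m k hn hm
      exact (hL.small k _ (hbL (k + 1))).dist_snd_le ⟨_, (hp (k + 1)).1⟩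
        (hanti (by omega : k + 1 ≤ n + 1) (hp (n + 1)).2)
        (hanti (by omega : k + 1 ≤ m + 1) (hp (m + 1)).2)
    obtain ⟨y, hy⟩ := cauchySeq_tendsto_of_complete hcauchy
    have hyW : ∀ n, y ∈ W (b n) := by
      intro n
      refine hbW n (mem_closure_of_tendsto hy ?_)
      filter_upwards [Filter.eventually_ge_atTop n] with m hm
      exact hanti (by omega : n + 1 ≤ m + 1) (hp (m + 1)).2
    obtain ⟨n, hn⟩ := mem_iUnion.1 (hGK (a := y) ⟨trivial, mem_iInter.2 fun n =>
      mem_iUnion₂.2 ⟨b n, hbL n, hyW n⟩⟩)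
    have hmem : y ∈ W (φ n (b n)) ∩ K n := ⟨hbs n ▸ hyW (n + 1), hn⟩
    rw [hφK n _ (hbL n)] at hmem
    exact hmem
  obtain ⟨c, hc, hcG⟩ := hL.exists_isSelectionScheme hb (by
    by_contra h
    rw [not_nonempty_iff_eq_empty] at h
    exact hG (h ▸ hI0))
  exact ⟨c, hc, fun h => hG (hI.mono hcG h)⟩

end Positive

/-- A set with `I`-positive projection admits a selection scheme whose coded `G_δ` set is
`I`-positive. -/
theorem exists_positive_selectionScheme {Z X : Type*} [MetricSpace Z] [MetricSpace X]
    [CompleteSpace X] {Q : ℕ → Set Z} {W : ℕ → Set X} (hb : IsBoxBasis Q W) {I : Set (Set X)}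
    (hI : SigmaIdeal I) (hgen : GeneratedByClosedSets I) (hI0 : ∅ ∈ I) {F : Set (Z × X)}
    (hpos : Prod.snd '' F ∉ I) :
    ∃ c, IsSelectionScheme Q W (SmallBox Q W) F c ∧ codedSet W c ∉ I := by
  obtain ⟨F', hF'F, ⟨p, hp⟩, hF'⟩ := exists_everywhere_positive hb hI hI0 hpos
  suffices h : ∃ c, IsSelectionScheme Q W (SmallBox Q W) F' c ∧ codedSet W c ∉ I by
    obtain ⟨c, hc, hcI⟩ := h
    exact ⟨c, ⟨hc.small, hc.coherent, fun k => (hc.meets k).mono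
      (inter_subset_inter_right _ hF'F)⟩, hcI⟩
  obtain ⟨r, hr, -⟩ := hb.exists_subset univ isOpen_univ p trivial
  by_cases hN : ∀ i, ((Q i ×ˢ W i) ∩ F').Nonempty →
      ∃ N ⊆ closure (Prod.snd '' ((Q i ×ˢ W i) ∩ F')), IsClosed N ∧
      (∀ V, IsOpen V → (V ∩ closure (Prod.snd '' ((Q i ×ˢ W i) ∩ F'))).Nonempty →
        ((V ∩ closure (Prod.snd '' ((Q i ×ˢ W i) ∩ F'))) \ N).Nonempty) ∧ N ∉ I
  · exact exists_positive_scheme_of_accumulation hb hI hgen ⟨p, hr, hp⟩ hI0 hN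
  · push Not at hN
    obtain ⟨i, hi, h⟩ := hN
    exact exists_positive_scheme_of_nowhereDense hb hI hI0 hF' hi h


theorem exists_selection_coding (Z X : Type*) [TopologicalSpace Z] [PolishSpace Z]
    [TopologicalSpace X] [PolishSpace X] :
    ∃ (Q : ℕ → Set Z) (W : ℕ → Set X) (small : ℕ → ℕ → Prop), IsBoxBasis Q W ∧
      (∀ F : Set (Z × X), IsClosed F → ∀ c, IsSelectionScheme Q W small F c →
        ∃ h : X → Z, ContinuousOn h (codedSet W c) ∧ ∀ y ∈ codedSet W c, (h y, y) ∈ F) ∧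
      ∀ I : Set (Set X), SigmaIdeal I → GeneratedByClosedSets I → ∅ ∈ I →
        ∀ F : Set (Z × X), Prod.snd '' F ∉ I →
          ∃ c, IsSelectionScheme Q W small F c ∧ codedSet W c ∉ I := by
  let _ := TopologicalSpace.upgradeIsCompletelyMetrizable Z
  let _ := TopologicalSpace.upgradeIsCompletelyMetrizable X
  obtain ⟨Q, W, hb⟩ := exists_isBoxBasis Z X
  exact ⟨Q, W, SmallBox Q W, hb, fun F hF c hc => hc.exists_continuousOn hb.isOpen_snd hF,
    fun I hI hgen hI0 F hF => exists_positive_selectionScheme hb hI hgen hI0 hF⟩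

theorem isOpen_setOf_apply_nat (k : ℕ) (p : ℕ → Prop) : IsOpen {c : ℕ → ℕ | p (c k)} :=
  (isOpen_discrete {i | p i}).preimage (continuous_apply k)

theorem isClosed_setOf_apply_nat₂ (k l : ℕ) (p : ℕ → ℕ → Prop) :
    IsClosed {c : ℕ → ℕ | p (c k) (c l)} := by
  have hcont : Continuous fun c : ℕ → ℕ => (c k, c l) :=
    (continuous_apply k).prodMk (continuous_apply l)
  exact (isClosed_discrete {q : ℕ × ℕ | p q.1 q.2}).preimage hcont

theorem analyticSet_inter {X : Type*} [TopologicalSpace X] [T2Space X] {A B : Set X}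
    (hA : MeasureTheory.AnalyticSet A) (hB : MeasureTheory.AnalyticSet B) :
    MeasureTheory.AnalyticSet (A ∩ B) := by
  rw [inter_eq_iInter]
  exact MeasureTheory.AnalyticSet.iInter fun b => by cases b <;> assumption

theorem isGδ_setOf_mem_codedSet {Y X : Type*} [TopologicalSpace Y] [TopologicalSpace X]
    {W : ℕ → Set X} (hW : ∀ i, IsOpen (W i)) {D : Set Y} (hD : IsGδ D) {g : Y → ℕ → ℕ}
    (hg : ContinuousOn g D) : IsGδ {p : Y × X | p.1 ∈ D ∧ p.2 ∈ codedSet W (g p.1)} := by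
  have hopen : ∀ n : ℕ, ∃ O : Set (Y × X), IsOpen O ∧ ∀ p : Y × X, p.1 ∈ D →
      ((∃ m, p.2 ∈ W (g p.1 (Nat.pair n m))) ↔ p ∈ O) := by
    intro n
    have : ∀ k i : ℕ, ∃ U : Set Y, IsOpen U ∧ ∀ x ∈ D, g x k = i ↔ x ∈ U := by
      intro k i
      obtain ⟨U, hU, hUeq⟩ := continuousOn_iff'.1 hg _ (isOpen_setOf_apply_nat k (· = i))
      refine ⟨U, hU, fun x hx => ?_⟩
      have := congrArg (x ∈ ·) hUeq
      simpa [hx] using this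
    choose U hU hUD using this
    refine ⟨⋃ m, ⋃ i, U (Nat.pair n m) i ×ˢ W i,
      isOpen_iUnion fun m => isOpen_iUnion fun i => (hU _ _).prod (hW i), fun p hp => ?_⟩
    simp only [mem_iUnion, mem_prod, ← hUD _ _ _ hp]
    simp
  choose O hO hOD using hopen
  have : {p : Y × X | p.1 ∈ D ∧ p.2 ∈ codedSet W (g p.1)} = Prod.fst ⁻¹' D ∩ ⋂ n, O n := by
    ext p
    simp only [codedSet, mem_ofPred_eq, mem_iInter, mem_iUnion, mem_inter_iff, mem_preimage]
    exact and_congr_right fun hp => forall_congr' fun n => hOD n p hp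
  rw [this]
  exact (hD.preimage continuous_fst).inter (IsGδ.iInter_of_isOpen hO)

/-- The set of selection schemes coding positive sets inside the sections of an analytic set is
analytic. -/
theorem analyticSet_setOf_isSelectionScheme {X : Type*} [TopologicalSpace X] [PolishSpace X]
    {I : Set (Set X)} (hIp : Pi11OnSigma11 I) {Q : ℕ → Set (ℕ → ℕ)} {W : ℕ → Set X}
    (hb : IsBoxBasis Q W) (small : ℕ → ℕ → Prop) {f : (ℕ → ℕ) → X × X} (hf : Continuous f) :
    MeasureTheory.AnalyticSet {p : X × (ℕ → ℕ) |
      IsSelectionScheme Q W small {q : (ℕ → ℕ) × X | f q.1 = (p.1, q.2)} p.2 ∧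
        codedSet W p.2 ∉ I} := by
  have hsmall : MeasureTheory.AnalyticSet {p : X × (ℕ → ℕ) | ∀ n m,
      small n (p.2 (Nat.pair n m))} := by
    refine IsClosed.analyticSet ?_
    simp only [ofPred_forall]
    exact isClosed_iInter fun n => isClosed_iInter fun m =>
      (isClosed_setOf_apply_nat₂ (Nat.pair n m) 0 fun i _ => small n i).preimage continuous_snd
  have hcoh : MeasureTheory.AnalyticSet {p : X × (ℕ → ℕ) | ∀ k l,
      (W (p.2 k) ∩ W (p.2 l)).Nonempty → (Q (p.2 k) ∩ Q (p.2 l)).Nonempty} := by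
    refine IsClosed.analyticSet ?_
    simp only [ofPred_forall]
    exact isClosed_iInter fun k => isClosed_iInter fun l =>
      (isClosed_setOf_apply_nat₂ k l fun i j => (W i ∩ W j).Nonempty →
        (Q i ∩ Q j).Nonempty).preimage continuous_snd
  have hmeets : MeasureTheory.AnalyticSet {p : X × (ℕ → ℕ) | ∀ k,
      ((Q (p.2 k) ×ˢ W (p.2 k)) ∩ {q : (ℕ → ℕ) × X | f q.1 = (p.1, q.2)}).Nonempty} := by
    simp only [ofPred_forall]
    refine MeasureTheory.AnalyticSet.iInter fun k => ?_
    have heq : {p : X × (ℕ → ℕ) |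
        ((Q (p.2 k) ×ˢ W (p.2 k)) ∩ {q : (ℕ → ℕ) × X | f q.1 = (p.1, q.2)}).Nonempty} =
        ⋃ i, (fun r : (ℕ → ℕ) × (ℕ → ℕ) => ((f r.1).1, r.2)) ''
          ((Q i ∩ (fun z => (f z).2) ⁻¹' W i) ×ˢ {c | c k = i}) := by
      ext ⟨x, c⟩
      simp only [mem_ofPred_eq, mem_iUnion, mem_image, Prod.exists]
      constructor
      · rintro ⟨⟨z, y⟩, ⟨hz, hy⟩, hzy⟩
        have hzy' : f z = (x, y) := hzy
        refine ⟨c k, z, c, ⟨⟨hz, ?_⟩, rfl⟩, by rw [hzy']⟩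
        simpa [hzy'] using hy
      · rintro ⟨i, z, c', ⟨⟨hz, hy⟩, rfl⟩, h⟩
        obtain ⟨rfl, rfl⟩ := Prod.mk.inj h
        exact ⟨(z, (f z).2), ⟨hz, hy⟩, rfl⟩
    rw [heq]
    refine MeasureTheory.AnalyticSet.iUnion fun i => IsOpen.analyticSet_image ?_ ?_
    · exact ((hb.isOpen_fst i).inter ((hb.isOpen_snd i).preimage (continuous_snd.comp hf))).prod
        (isOpen_setOf_apply_nat k (· = i))
    · exact (continuous_fst.comp (hf.comp continuous_fst)).prodMk continuous_snd
  have hpos : MeasureTheory.AnalyticSet {p : X × (ℕ → ℕ) | codedSet W p.2 ∉ I} := by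
    borelize X
    have hG : IsGδ {p : (ℕ → ℕ) × X | p.1 ∈ univ ∧ p.2 ∈ codedSet W (id p.1)} :=
      isGδ_setOf_mem_codedSet hb.isOpen_snd IsGδ.univ continuousOn_id
    have h := hIp _ (hG.measurableSet.analyticSet)
    convert h.preimage (continuous_snd (X := X)) using 1
    ext p
    simp
  convert analyticSet_inter (analyticSet_inter hsmall hcoh) (analyticSet_inter hmeets hpos) using 1
  ext p
  exact ⟨fun h => ⟨⟨h.1.small, h.1.coherent⟩, h.1.meets, h.2⟩,
    fun h => ⟨⟨h.1.1, h.1.2, h.2.1⟩, h.2.2⟩⟩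

theorem analytic_fubini_dichotomy_dim_two
    {X : Type*} [TopologicalSpace X] [PolishSpace X]
    (I : Set (Set X)) (hI : SigmaIdeal I) (hIp : Pi11OnSigma11 I)
    (hgen : GeneratedByClosedSets I)
    (A : Set (X × X)) (hA : MeasureTheory.AnalyticSet A) :
    A ∈ FubiniProd I I ∨ ∃ G ⊆ A, IsGδ G ∧ G ∉ FubiniProd I I := by
  refine or_iff_not_imp_left.2 fun hAI => ?_
  by_cases hI0 : ∅ ∈ I
  swap
  · exact ⟨∅, empty_subset _, IsGδ.empty, fun h => hI0 (hI.mono (empty_subset _) h)⟩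
  have hAI' : {x : X | {y : X | (x, y) ∈ A} ∉ I} ∉ I := hAI
  rw [MeasureTheory.AnalyticSet] at hA
  rcases hA with rfl | ⟨f, hf, rfl⟩
  · exact absurd (by simp [hI0]) hAI'
  obtain ⟨Q, W, small, hb, hsel, hpos⟩ := exists_selection_coding (ℕ → ℕ) X
  have hE := analyticSet_setOf_isSelectionScheme hIp hb small hf
  set E : Set (X × (ℕ → ℕ)) := {p | IsSelectionScheme Q W small
    {q : (ℕ → ℕ) × X | f q.1 = (p.1, q.2)} p.2 ∧ codedSet W p.2 ∉ I}
  have hproj : Prod.fst '' E ∉ I := by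
    refine fun h => hAI' (hI.mono (fun x hx => ?_) h)
    obtain ⟨c, hc, hcI⟩ := hpos I hI hgen hI0 {q | f q.1 = (x, q.2)} (by
      convert! hx using 2
      ext y
      simp)
    exact ⟨(x, c), ⟨hc, hcI⟩, rfl⟩
  rw [MeasureTheory.AnalyticSet] at hE
  rcases hE with hE | ⟨g, hg, hgE⟩
  · exact absurd (by simpa [hE] using hI0) hproj
  obtain ⟨c, hc, hcI⟩ := hpos I hI hgen hI0 {q | (g q.1).1 = q.2} (by
    convert! hproj using 2
    rw [← hgE]
    ext y
    simp)
  obtain ⟨h, hh, hhF⟩ := hsel _ (isClosed_eq (continuous_fst.comp (hg.comp continuous_fst))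
    continuous_snd) c hc
  have hmem : ∀ x ∈ codedSet W c, (x, (g (h x)).2) ∈ E := by
    intro x hx
    have h1 : (g (h x)).1 = x := hhF x hx
    have h2 : g (h x) ∈ E := hgE ▸ mem_range_self _
    rwa [← Prod.mk.eta (p := g (h x)), h1] at h2
  refine ⟨{p | p.1 ∈ codedSet W c ∧ p.2 ∈ codedSet W ((g (h p.1)).2)}, ?_,
    isGδ_setOf_mem_codedSet hb.isOpen_snd (isGδ_codedSet hb.isOpen_snd c)
      (g := fun x => (g (h x)).2) ((continuous_snd.comp hg).comp_continuousOn hh), ?_⟩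
  · rintro ⟨x, y⟩ ⟨hx, hy⟩
    obtain ⟨k, -, hk⟩ := hsel _ (isClosed_eq (hf.comp continuous_fst)
      (continuous_const.prodMk continuous_snd)) _ (hmem x hx).1
    exact ⟨k y, hk y hy⟩
  · intro hG
    refine hcI (hI.mono ?_ (show {x : X | {y : X | (x, y) ∈ {p : X × X | p.1 ∈ codedSet W c ∧
      p.2 ∈ codedSet W ((g (h p.1)).2)}} ∉ I} ∈ I from hG))
    intro x hx hGx
    exact (hmem x hx).2 (hI.mono (fun y hy => And.intro hx hy) hGx)
end

section
/- Let X be a Polish space and let f : X → ω^ω be a function of Baire class 1 (the preimage under f of every open set is Fσ). Suppose G ⊆ X is a Gδ set with G ∉ I^f. Then there exist an open set U ⊆ ω^ω and a topological embedding c : 2^ω → X with compact image C = c[2^ω] such that f⁻¹[U] ∩ C = c[Q] and C \ c[Q] ⊆ G, where Q ⊆ 2^ω is the set of binary sequences that are eventually equal to 0. -/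
open Set

/-- `f` is of Baire class 1: the preimage of every open set is `Fσ`. -/
def BaireClassOne {X : Type*} [TopologicalSpace X] (f : X → (ℕ → ℕ)) : Prop :=
  ∀ U : Set (ℕ → ℕ), IsOpen U →
    ∃ F : ℕ → Set X, (∀ n, IsClosed (F n)) ∧ f ⁻¹' U = ⋃ n, F n

/-- The σ-ideal `I^f` generated by the closed sets on which `f` is continuous:
`A ∈ I^f` iff `A` is covered by countably many closed sets on which `f` restricts
to a continuous function. -/
def contIdeal {X : Type*} [TopologicalSpace X] (f : X → (ℕ → ℕ)) : Set (Set X) :=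
  {A | ∃ C : ℕ → Set X, (∀ n, IsClosed (C n) ∧ ContinuousOn f (C n)) ∧ A ⊆ ⋃ n, C n}

/-- `Q`: the set of binary sequences eventually equal to `0` (i.e. `false`). -/
def eventuallyZero : Set (ℕ → Bool) :=
  {x | ∀ᶠ n in Filter.atTop, x n = false}

section Ideal

variable {X : Type*} [TopologicalSpace X] {f : X → (ℕ → ℕ)} {A B : Set X} {x : X}

theorem contIdeal_mono (h : A ⊆ B) (hB : B ∈ contIdeal f) : A ∈ contIdeal f := by
  obtain ⟨C, hC, hBC⟩ := hB
  exact ⟨C, hC, h.trans hBC⟩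

theorem iUnion_mem_contIdeal {A : ℕ → Set X} (h : ∀ n, A n ∈ contIdeal f) :
    ⋃ n, A n ∈ contIdeal f := by
  choose C hC hAC using h
  refine ⟨fun k => C k.unpair.1 k.unpair.2, fun k => hC _ _, iUnion_subset fun n x hx => ?_⟩
  obtain ⟨m, hm⟩ := mem_iUnion.1 (hAC n hx)
  exact mem_iUnion.2 ⟨Nat.pair n m, by simpa using hm⟩

theorem empty_mem_contIdeal : ∅ ∈ contIdeal f :=
  ⟨fun _ => ∅, fun _ => ⟨isClosed_empty, continuousOn_empty f⟩, empty_subset _⟩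

theorem biUnion_mem_contIdeal {ι : Type*} {s : Set ι} (hs : s.Countable) {A : ι → Set X}
    (h : ∀ i ∈ s, A i ∈ contIdeal f) : ⋃ i ∈ s, A i ∈ contIdeal f := by
  rcases s.eq_empty_or_nonempty with rfl | hne
  · simpa using empty_mem_contIdeal
  · obtain ⟨g, rfl⟩ := hs.exists_eq_range hne
    rw [biUnion_range]
    exact iUnion_mem_contIdeal fun n => h _ (mem_range_self n)

theorem union_mem_contIdeal (hA : A ∈ contIdeal f) (hB : B ∈ contIdeal f) :
    A ∪ B ∈ contIdeal f := by
  rw [union_eq_iUnion, ← biUnion_univ]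
  exact biUnion_mem_contIdeal (countable_univ) (by rintro (_ | _) _ <;> assumption)

/-- Every neighbourhood of `x` meets `B` in a set outside `contIdeal f`. -/
def ThickAt (f : X → (ℕ → ℕ)) (B : Set X) (x : X) : Prop :=
  ∀ A ∈ nhds x, B ∩ A ∉ contIdeal f

theorem ThickAt.mono (h : A ⊆ B) (hA : ThickAt f A x) : ThickAt f B x :=
  fun V hV hB => hA V hV (contIdeal_mono (inter_subset_inter_left V h) hB)

theorem thickAt_union : ThickAt f (A ∪ B) x ↔ ThickAt f A x ∨ ThickAt f B x := by
  refine ⟨fun h => ?_, fun h => h.elim (.mono subset_union_left) (.mono subset_union_right)⟩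
  by_contra hn
  simp only [ThickAt, not_or, not_forall, not_not] at hn
  obtain ⟨⟨V, hV, hA⟩, V', hV', hB⟩ := hn
  refine h (V ∩ V') (Filter.inter_mem hV hV') (contIdeal_mono ?_ (union_mem_contIdeal hA hB))
  rw [union_inter_distrib_right]
  gcongr
  exacts [inter_subset_left, inter_subset_right]

theorem ThickAt.not_mem (h : ThickAt f B x) : B ∉ contIdeal f := by
  simpa using h univ Filter.univ_mem

theorem isClosed_setOf_thickAt : IsClosed {x | ThickAt f B x} := by
  rw [← isOpen_compl_iff, isOpen_iff_mem_nhds]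
  intro x hx
  simp only [mem_compl_iff, mem_ofPred_eq, ThickAt, not_forall, not_not] at hx
  obtain ⟨V, hV, hB⟩ := hx
  filter_upwards [eventually_mem_nhds_iff.2 hV] with y hy h
  exact h V hy hB

theorem diff_thickAt_mem_contIdeal [SecondCountableTopology X] :
    B \ {x | ThickAt f B x} ∈ contIdeal f := by
  have key : ∀ x ∈ B \ {x | ThickAt f B x}, ∃ V ∈ nhds x, B ∩ V ∈ contIdeal f := by
    rintro x ⟨-, hx⟩
    simpa [ThickAt] using hx
  choose! V hV hB using key
  obtain ⟨t, hts, htc, ht⟩ := TopologicalSpace.countable_cover_nhdsWithin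
    (fun x hx => mem_nhdsWithin_of_mem_nhds (hV x hx))
  refine contIdeal_mono (fun y hy => ?_) (biUnion_mem_contIdeal htc fun x hx => hB x (hts hx))
  obtain ⟨x, hx, hxy⟩ := mem_iUnion₂.1 (ht hy)
  exact mem_iUnion₂.2 ⟨x, hx, hy.1, hxy⟩

theorem exists_thickAt [SecondCountableTopology X] (h : B ∉ contIdeal f) :
    ∃ x ∈ B, ThickAt f B x := by
  by_contra! hn
  exact h (contIdeal_mono (fun x hx => show x ∈ B \ {x | ThickAt f B x} from ⟨hx, hn x hx⟩)
    diff_thickAt_mem_contIdeal)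

theorem ThickAt.exists_mem_inter [SecondCountableTopology X] (h : ThickAt f B x) {V : Set X}
    (hV : V ∈ nhds x) : ∃ y ∈ B ∩ V, ThickAt f B y := by
  obtain ⟨y, hy, hyt⟩ := exists_thickAt (h V hV)
  exact ⟨y, hy, hyt.mono inter_subset_left⟩

/-- A function of Baire class one cannot take values in a clopen set `W` densely often on the thick
part of a set `B` that it maps outside `W`. -/
theorem BaireClassOne.exists_isOpen_disjoint_thickAt [PolishSpace X] (hf : BaireClassOne f)
    (hB : B ∉ contIdeal f) {W : Set (ℕ → ℕ)} (hW : IsClopen W) (hBW : ∀ x ∈ B, f x ∉ W) :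
    ∃ V : Set X, IsOpen V ∧ (∃ x ∈ V, ThickAt f B x) ∧ ∀ x ∈ V, ThickAt f B x → f x ∉ W := by
  obtain ⟨F, hF, hFW⟩ := hf W hW.isOpen
  obtain ⟨E, hE, hEW⟩ := hf Wᶜ hW.compl.isOpen
  set Z : Set X := {x | ThickAt f B x}
  obtain ⟨z, hz⟩ := exists_thickAt hB
  have hZ : IsClosed Z := isClosed_setOf_thickAt
  have : PolishSpace Z := hZ.polishSpace
  have : Nonempty Z := ⟨⟨z, hz.2⟩⟩
  obtain ⟨i, hi⟩ := nonempty_interior_of_iUnion_of_closed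
    (f := fun i : ℕ ⊕ ℕ => ((↑) : Z → X) ⁻¹' (Sum.elim F E i))
    (by rintro (i | i); exacts [(hF i).preimage continuous_subtype_val,
          (hE i).preimage continuous_subtype_val])
    (by
      rw [← preimage_iUnion, iUnion_sum]
      simp only [Sum.elim_inl, Sum.elim_inr]
      rw [← hFW, ← hEW, ← preimage_union, union_compl_self]
      rfl)
  obtain ⟨V, hV, hVi⟩ := isOpen_induced_iff.1
    (isOpen_interior (s := ((↑) : Z → X) ⁻¹' (Sum.elim F E i)))
  have hsub : ∀ x ∈ V, ThickAt f B x → x ∈ Sum.elim F E i := fun x hx hxt => by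
    have : (⟨x, hxt⟩ : Z) ∈ ((↑) : Z → X) ⁻¹' V := hx
    rw [hVi] at this
    exact interior_subset (s := ((↑) : Z → X) ⁻¹' (Sum.elim F E i)) this
  obtain ⟨⟨y, hyZ⟩, hy⟩ := hi
  rw [← hVi] at hy
  refine ⟨V, hV, ⟨y, hy, hyZ⟩, fun x hx hxt hxW => ?_⟩
  rcases i with i | i
  · obtain ⟨u, hu, hut⟩ := ThickAt.exists_mem_inter hyZ (hV.mem_nhds hy)
    have : u ∈ f ⁻¹' W := hFW ▸ mem_iUnion.2 ⟨i, hsub u hu.2 hut⟩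
    exact hBW u hu.1 this
  · have : x ∈ f ⁻¹' Wᶜ := hEW ▸ mem_iUnion.2 ⟨i, hsub x hx hxt⟩
    exact this hxW

theorem mem_contIdeal_of_isOpen_inter_isClosed [TopologicalSpace.MetrizableSpace X] {V Z : Set X}
    (hV : IsOpen V) (hZ : IsClosed Z) (h : ContinuousOn f (V ∩ Z)) : V ∩ Z ∈ contIdeal f := by
  let := TopologicalSpace.metrizableSpaceMetric X
  obtain ⟨F, hF, -, hFV, -⟩ := hV.exists_iUnion_isClosed
  refine ⟨fun n => F n ∩ Z, fun n => ⟨(hF n).inter hZ, h.mono ?_⟩, ?_⟩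
  · exact inter_subset_inter_left Z (hFV ▸ subset_iUnion F n)
  · rw [← iUnion_inter, hFV]

theorem continuousOn_of_thickAt {V : Set X}
    (h : ∀ x ∈ V, ThickAt f B x → ∀ W, IsClopen W → f x ∈ W → ¬ ThickAt f (B \ f ⁻¹' W) x) :
    ContinuousOn f (V ∩ {x | ThickAt f B x}) := by
  refine continuousOn_pi.2 fun i x hx => ?_
  have hW : IsClopen {z : ℕ → ℕ | z i = f x i} :=
    (isClopen_discrete {f x i}).preimage (continuous_apply i)
  have hxW := h x hx.1 hx.2 _ hW rfl
  simp only [ThickAt, not_forall, not_not] at hxW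
  obtain ⟨A, hA, hAB⟩ := hxW
  rw [ContinuousWithinAt, nhds_discrete, Filter.tendsto_pure, eventually_nhdsWithin_iff]
  filter_upwards [eventually_mem_nhds_iff.2 hA] with y hyA hy
  by_contra hne
  refine h y hy.1 hy.2 _ hW.compl hne fun A' hA' hB' => ?_
  refine hy.2 (A ∩ A') (Filter.inter_mem hyA hA')
    (contIdeal_mono ?_ (union_mem_contIdeal hAB hB'))
  rintro u ⟨huB, huA, huA'⟩
  by_cases hu : f u i = f x i
  exacts [.inr ⟨⟨huB, fun hn => hn hu⟩, huA'⟩, .inl ⟨⟨huB, hu⟩, huA⟩]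

theorem BaireClassOne.exists_thickAt_diff [PolishSpace X] (hf : BaireClassOne f)
    (hB : B ∉ contIdeal f) {W : Set (ℕ → ℕ)} (hW : IsClopen W) (hBW : ∀ x ∈ B, f x ∉ W)
    {O : Set X} (hO : IsOpen O) (hBO : B ⊆ O) :
    ∃ x ∈ O, ∃ W', IsClopen W' ∧ Disjoint W W' ∧ f x ∈ W' ∧ ThickAt f (B \ f ⁻¹' W') x := by
  obtain ⟨V, hV, ⟨z, hzV, hz⟩, hVW⟩ := hf.exists_isOpen_disjoint_thickAt hB hW hBW
  obtain ⟨y, hy, hyt⟩ := hz.exists_mem_inter (hV.mem_nhds hzV)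
  by_contra! hn
  have hc := mem_contIdeal_of_isOpen_inter_isClosed (hV.inter hO) isClosed_setOf_thickAt
    (continuousOn_of_thickAt (f := f) (B := B) fun x hx hxt W' hW' hxW' ht =>
      hn x hx.2 (W' \ W) (hW'.diff hW) disjoint_sdiff_right ⟨hxW', hVW x hx.1 hxt⟩
        (ht.mono (sdiff_subset_sdiff_right (preimage_mono sdiff_subset))))
  refine hyt (V ∩ O) ((hV.inter hO).mem_nhds ⟨hy.2, hBO hy.1⟩)
    (contIdeal_mono ?_ (union_mem_contIdeal hc (diff_thickAt_mem_contIdeal (B := B))))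
  rintro u ⟨huB, hu⟩
  by_cases h : ThickAt f B u
  exacts [.inl ⟨hu, h⟩, .inr ⟨huB, h⟩]

/-- Among sufficiently many disjoint candidates, one can be removed from the range of `f` without
destroying thickness at finitely many prescribed points. -/
theorem BaireClassOne.exists_thickAt_preserving [PolishSpace X] (hf : BaireClassOne f)
    {G S : Set X} (hS : S.Finite) {W : Set (ℕ → ℕ)} (hSW : ∀ s ∈ S, ThickAt f (G \ f ⁻¹' W) s)
    {O : Set X} (hO : IsOpen O) (hB : B ∉ contIdeal f) {T : Set (ℕ → ℕ)} (hT : IsClopen T)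
    (hBT : ∀ x ∈ B, f x ∉ T) (hBO : B ⊆ O) :
    ∃ x ∈ O, ∃ W', IsClopen W' ∧ Disjoint T W' ∧ f x ∈ W' ∧ ThickAt f (B \ f ⁻¹' W') x ∧
      ∀ s ∈ S, ThickAt f (G \ f ⁻¹' (W ∪ W')) s := by
  induction S, hS using Set.Finite.induction_on generalizing B T with
  | empty =>
    obtain ⟨x, hx, W', hW', hd, hxW', ht⟩ := hf.exists_thickAt_diff hB hT hBT hO hBO
    exact ⟨x, hx, W', hW', hd, hxW', ht, by simp⟩
  | @insert s S _ _ ih =>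
    have hSW' : ∀ s ∈ S, ThickAt f (G \ f ⁻¹' W) s := fun u hu => hSW u (.inr hu)
    obtain ⟨x, hx, W₁, hW₁, hd₁, hxW₁, hxt, h₁⟩ := ih hSW' hB hT hBT hBO
    by_cases hs₁ : ThickAt f (G \ f ⁻¹' (W ∪ W₁)) s
    · exact ⟨x, hx, W₁, hW₁, hd₁, hxW₁, hxt, forall_mem_insert.2 ⟨hs₁, h₁⟩⟩
    obtain ⟨y, hy, W₂, hW₂, hd₂, hyW₂, hyt, h₂⟩ := ih hSW' hxt.not_mem (hT.union hW₁)
      (fun x hx => not_or.2 ⟨hBT x hx.1, hx.2⟩) (sdiff_subset.trans hBO)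
    rw [disjoint_union_left] at hd₂
    refine ⟨y, hy, W₂, hW₂, hd₂.1, hyW₂, hyt.mono (sdiff_subset_sdiff_left sdiff_subset),
      forall_mem_insert.2 ⟨?_, h₂⟩⟩
    have hunion : ThickAt f (G \ f ⁻¹' (W ∪ W₁) ∪ G \ f ⁻¹' (W ∪ W₂)) s := by
      refine (hSW s (.inl rfl)).mono ?_
      rintro u ⟨huG, hu⟩
      by_cases hu₁ : f u ∈ W₁
      · exact .inr ⟨huG, not_or.2 ⟨hu, fun hu₂ => hd₂.2.le_bot ⟨hu₁, hu₂⟩⟩⟩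
      · exact .inl ⟨huG, not_or.2 ⟨hu, hu₁⟩⟩
    exact (thickAt_union.1 hunion).resolve_left hs₁

theorem BaireClassOne.exists_thickAt_family [PolishSpace X] (hf : BaireClassOne f)
    {G S O : Set X} (hS : S.Finite) {W : Set (ℕ → ℕ)} (hW : IsClopen W)
    (hSW : ∀ s ∈ S, ThickAt f (G \ f ⁻¹' W) s) (hO : IsOpen O) (hGO : G \ f ⁻¹' W ⊆ O)
    {ι : Type*} {t : Set ι} (ht : t.Finite) {q : ι → X} (hq : ∀ i ∈ t, q i ∈ S)
    {N : ι → Set X} (hN : ∀ i ∈ t, IsOpen (N i)) (hqN : ∀ i ∈ t, q i ∈ N i) :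
    ∃ W', IsClopen W' ∧ W ⊆ W' ∧ (∀ s ∈ S, ThickAt f (G \ f ⁻¹' W') s) ∧
      ∀ i ∈ t, ∃ x ∈ N i ∩ O, f x ∉ W ∧ f x ∈ W' ∧ ThickAt f (G \ f ⁻¹' W') x := by
  induction t, ht using Set.Finite.induction_on with
  | empty => exact ⟨W, hW, subset_rfl, hSW, by simp⟩
  | @insert i t _ htf ih =>
    obtain ⟨W₁, hW₁, hWW₁, hS₁, hx⟩ := ih (fun j hj => hq j (.inr hj))
      (fun j hj => hN j (.inr hj)) (fun j hj => hqN j (.inr hj))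
    have : Nonempty X := ⟨q i⟩
    choose! x hxN hxW hxW₁ hxt using hx
    have hNi := hN i (.inl rfl)
    have hanti : G \ f ⁻¹' W₁ ⊆ G \ f ⁻¹' W := sdiff_subset_sdiff_right (preimage_mono hWW₁)
    obtain ⟨y, hy, W₂, hW₂, hd, hyW₂, hyt, h₂⟩ := hf.exists_thickAt_preserving
      (G := G) (W := W₁) (B := (G \ f ⁻¹' W₁) ∩ N i) (T := W₁) (hS.union (htf.image x))
      (by
        rintro s (hs | ⟨j, hj, rfl⟩)
        exacts [hS₁ s hs, hxt j hj])
      (hNi.inter hO) (hS₁ _ (hq i (.inl rfl)) (N i) (hNi.mem_nhds (hqN i (.inl rfl)))) hW₁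
      (fun u hu => hu.1.2) (fun u hu => ⟨hu.2, hGO (hanti hu.1)⟩)
    refine ⟨W₁ ∪ W₂, hW₁.union hW₂, hWW₁.trans subset_union_left, fun s hs => h₂ s (.inl hs),
      forall_mem_insert.2 ⟨⟨y, hy, fun h => hd.le_bot ⟨hWW₁ h, hyW₂⟩, .inr hyW₂, hyt.mono ?_⟩,
        fun j hj => ⟨x j, hxN j hj, hxW j hj, .inl (hxW₁ j hj), h₂ _ (.inr ⟨j, hj, rfl⟩)⟩⟩⟩
    rintro u ⟨⟨⟨huG, hu₁⟩, -⟩, hu₂⟩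
    exact ⟨huG, not_or.2 ⟨hu₁, hu₂⟩⟩

end Ideal

section Scheme

variable {X : Type*}

theorem exists_isOpen_closure_subset_ediam_le [PseudoMetricSpace X] {V : Set X} (hV : IsOpen V)
    {x : X} (hx : x ∈ V) {ε : ENNReal} (hε : ε ≠ 0) :
    ∃ V', IsOpen V' ∧ x ∈ V' ∧ closure V' ⊆ V ∧ Metric.ediam V' ≤ ε := by
  have hε2 : 0 < ε / 2 := ENNReal.half_pos hε
  obtain ⟨C, hC, hCc, hCV⟩ := exists_mem_nhds_isClosed_subset
    (Filter.inter_mem (hV.mem_nhds hx) (Metric.eball_mem_nhds x hε2))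
  refine ⟨interior C, isOpen_interior, mem_interior_iff_mem_nhds.2 hC,
    (closure_minimal interior_subset hCc).trans (hCV.trans inter_subset_left), ?_⟩
  calc Metric.ediam (interior C) ≤ Metric.ediam (Metric.eball x (ε / 2)) :=
        Metric.ediam_mono (interior_subset.trans (hCV.trans inter_subset_right))
    _ ≤ 2 * (ε / 2) := Metric.ediam_eball_le
    _ = ε := ENNReal.mul_div_cancel two_ne_zero ENNReal.ofNat_ne_top

/-- A level of the Hurewicz scheme: points and neighbourhoods indexed by binary strings, a set
`val` of values of `f`, and a sequence of sets exhausting the preimage of `val`. -/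
structure HurewiczStage (X : Type*) where
  pt : List Bool → X
  nhd : List Bool → Set X
  val : Set (ℕ → ℕ)
  piece : ℕ → Set X

/-- The requirements on a stage at level `n`, where only strings of length `n` matter. -/
structure HurewiczStage.Valid [TopologicalSpace X] (f : X → (ℕ → ℕ)) (G : Set X) (n : ℕ)
    (σ : HurewiczStage X) : Prop where
  isClopen_val : IsClopen σ.val
  monotone_piece : Monotone σ.piece
  isClosed_piece : ∀ j, IsClosed (σ.piece j)
  preimage_val : f ⁻¹' σ.val = ⋃ j, σ.piece j
  isOpen_nhd : ∀ l, l.length = n → IsOpen (σ.nhd l)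
  pt_mem_nhd : ∀ l, l.length = n → σ.pt l ∈ σ.nhd l
  apply_pt_mem : ∀ l, l.length = n → f (σ.pt l) ∈ σ.val
  thickAt_pt : ∀ l, l.length = n → ThickAt f (G \ f ⁻¹' σ.val) (σ.pt l)

/-- `τ` is a level `n + 1` successor of the level `n` stage `σ`. -/
structure HurewiczStage.Succ [PseudoMetricSpace X] (O : Set X) (n : ℕ)
    (σ τ : HurewiczStage X) : Prop where
  pt_false : ∀ l, l.length = n → τ.pt (false :: l) = σ.pt l
  closure_nhd : ∀ l, l.length = n → ∀ b, closure (τ.nhd (b :: l)) ⊆ σ.nhd l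
  ediam_nhd : ∀ l, l.length = n → ∀ b, Metric.ediam (τ.nhd (b :: l)) ≤ 2⁻¹ ^ n
  disjoint_nhd : ∀ l, l.length = n → Disjoint (τ.nhd (false :: l)) (τ.nhd (true :: l))
  nhd_true : ∀ l, l.length = n → τ.nhd (true :: l) ⊆ O \ σ.piece n
  val_subset : σ.val ⊆ τ.val
  piece_subset : ∀ j, σ.piece j ⊆ τ.piece j

theorem BaireClassOne.exists_monotone [TopologicalSpace X] {f : X → (ℕ → ℕ)}
    (hf : BaireClassOne f) {U : Set (ℕ → ℕ)} (hU : IsOpen U) :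
    ∃ F : ℕ → Set X, Monotone F ∧ (∀ n, IsClosed (F n)) ∧ f ⁻¹' U = ⋃ n, F n := by
  obtain ⟨F, hF, hFU⟩ := hf U hU
  refine ⟨accumulate F, monotone_accumulate, fun n => ?_, by rw [iUnion_accumulate, hFU]⟩
  rw [accumulate_def]
  exact (finite_Iic n).isClosed_biUnion fun i _ => hF i

variable {f : X → (ℕ → ℕ)} {G : Set X}

theorem BaireClassOne.exists_stage_zero [TopologicalSpace X] [PolishSpace X]
    (hf : BaireClassOne f) (hG : G ∉ contIdeal f) :
    ∃ σ : HurewiczStage X, σ.Valid f G 0 := by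
  obtain ⟨x, -, W, hW, -, hxW, hxt⟩ := hf.exists_thickAt_diff hG isClopen_empty (by simp)
    isOpen_univ (subset_univ _)
  obtain ⟨F, hmono, hF, hFW⟩ := hf.exists_monotone hW.isOpen
  exact ⟨⟨fun _ => x, fun _ => univ, W, F⟩, hW, hmono, hF, hFW, fun _ _ => isOpen_univ,
    fun _ _ => mem_univ _, fun _ _ => hxW, fun _ _ => hxt⟩

theorem HurewiczStage.Valid.exists_succ [MetricSpace X] [PolishSpace X] (hf : BaireClassOne f)
    {n : ℕ} {σ : HurewiczStage X} (hσ : σ.Valid f G n) {O : Set X} (hO : IsOpen O)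
    (hGO : G ⊆ O) : ∃ τ : HurewiczStage X, τ.Valid f G (n + 1) ∧ σ.Succ O n τ := by
  have ht : {l : List Bool | l.length = n}.Finite := List.finite_length_eq Bool n
  have hO' : IsOpen (O \ σ.piece n) := hO.sdiff (hσ.isClosed_piece n)
  obtain ⟨W, hW, hσW, hpt, hx⟩ := hf.exists_thickAt_family (ht.image σ.pt) hσ.isClopen_val
    (by rintro _ ⟨l, hl, rfl⟩; exact hσ.thickAt_pt l hl) hO'
    (fun u hu => ⟨hGO hu.1, fun h => hu.2 (hσ.preimage_val ▸ mem_iUnion_of_mem n h)⟩) ht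
    (fun l hl => mem_image_of_mem σ.pt hl) hσ.isOpen_nhd hσ.pt_mem_nhd
  have : Nonempty X := ⟨σ.pt []⟩
  choose! x hxN hxσ hxW hxt using hx
  have hsep : ∀ l, l.length = n → ∃ V : Bool → Set X, (∀ b, IsOpen (V b)) ∧ σ.pt l ∈ V false ∧
      x l ∈ V true ∧ (∀ b, closure (V b) ⊆ σ.nhd l) ∧ (∀ b, Metric.ediam (V b) ≤ 2⁻¹ ^ n) ∧
      Disjoint (V false) (V true) ∧ V true ⊆ O \ σ.piece n := by
    intro l hl
    have hne : σ.pt l ≠ x l := fun h => hxσ l hl (h ▸ hσ.apply_pt_mem l hl)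
    obtain ⟨A, B, hA, hB, hpA, hxB, hAB⟩ := t2_separation hne
    have hε : (2⁻¹ : ENNReal) ^ n ≠ 0 := pow_ne_zero _ (by simp)
    obtain ⟨V₀, hV₀, hpV₀, hcl₀, hd₀⟩ := exists_isOpen_closure_subset_ediam_le
      ((hσ.isOpen_nhd l hl).inter hA) ⟨hσ.pt_mem_nhd l hl, hpA⟩ hε
    obtain ⟨V₁, hV₁, hxV₁, hcl₁, hd₁⟩ := exists_isOpen_closure_subset_ediam_le
      (((hσ.isOpen_nhd l hl).inter hO').inter hB) ⟨hxN l hl, hxB⟩ hε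
    have hs₀ := subset_closure.trans hcl₀
    have hs₁ := subset_closure.trans hcl₁
    refine ⟨fun b => cond b V₁ V₀, by simp [hV₀, hV₁], hpV₀, hxV₁, ?_, by simp [hd₀, hd₁],
      hAB.mono (hs₀.trans inter_subset_right) (hs₁.trans inter_subset_right),
      hs₁.trans (inter_subset_left.trans inter_subset_right)⟩
    rintro (_ | _)
    exacts [hcl₀.trans inter_subset_left,
      hcl₁.trans (inter_subset_left.trans inter_subset_left)]
  choose! V hVo hpV hxV hcl hd hdisj hVO using hsep
  obtain ⟨F, hmono, hF, hFW⟩ := hf.exists_monotone hW.isOpen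
  have hσF (j : ℕ) : σ.piece j ⊆ ⋃ j, F j :=
    hFW ▸ (subset_iUnion _ j).trans (hσ.preimage_val ▸ preimage_mono hσW)
  refine ⟨⟨fun l => cond l.head! (x l.tail) (σ.pt l.tail), fun l => V l.tail l.head!, W,
    fun j => σ.piece j ∪ F j⟩, ⟨hW, hσ.monotone_piece.sup hmono,
      fun j => (hσ.isClosed_piece j).union (hF j), ?_, ?_, ?_, ?_, ?_⟩,
      ⟨fun _ _ => rfl, hcl, hd, hdisj, hVO, hσW, fun _ => subset_union_left⟩⟩
  · rw [iUnion_union_distrib, hFW, union_eq_self_of_subset_left (iUnion_subset hσF)]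
  all_goals
    rintro (_ | ⟨b, l⟩) hl
    · simp at hl
    replace hl : l.length = n := by simpa using hl
  · exact hVo l hl b
  · cases b
    exacts [hpV l hl, hxV l hl]
  · cases b
    exacts [hσW (hσ.apply_pt_mem l hl), hxW l hl]
  · cases b
    exacts [hpt _ ⟨l, hl, rfl⟩, hxt l hl]

end Scheme

theorem hurewicz_scheme_for_not_piecewise_continuous
    {X : Type*} [TopologicalSpace X] [PolishSpace X]
    (f : X → (ℕ → ℕ)) (hf : BaireClassOne f)
    (G : Set X) (hGδ : IsGδ G) (hG : G ∉ contIdeal f) :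
    ∃ (U : Set (ℕ → ℕ)) (c : (ℕ → Bool) → X), IsOpen U ∧
      Topology.IsEmbedding c ∧ IsCompact (Set.range c) ∧
      f ⁻¹' U ∩ Set.range c = c '' eventuallyZero ∧
      Set.range c \ c '' eventuallyZero ⊆ G := by
  let := TopologicalSpace.upgradeIsCompletelyMetrizable X
  obtain ⟨O, hO, hOG⟩ := hGδ.eq_iInter_nat
  let P (n : ℕ) : Set X := ⋂ m ∈ Iic n, O m
  have hP (n : ℕ) : IsOpen (P n) := (finite_Iic n).isOpen_biInter fun m _ => hO m
  have hGP (n : ℕ) : G ⊆ P n := hOG ▸ subset_iInter₂ fun m _ => iInter_subset O m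
  obtain ⟨σ₀, hσ₀⟩ := hf.exists_stage_zero hG
  have : Nonempty (HurewiczStage X) := ⟨σ₀⟩
  choose! next hnext hsucc using fun (n : ℕ) (σ : HurewiczStage X) (hσ : σ.Valid f G n) =>
    hσ.exists_succ hf (hP n) (hGP n)
  let σ (n : ℕ) : HurewiczStage X := Nat.rec σ₀ next n
  have hv (n : ℕ) : (σ n).Valid f G n := by
    induction n with
    | zero => exact hσ₀
    | succ n ih => exact hnext n _ ih
  have hs (n : ℕ) : (σ n).Succ (P n) n (σ (n + 1)) := hsucc n _ (hv n)
  have hval : Monotone fun n => (σ n).val := monotone_nat_of_le_succ fun n => (hs n).val_subset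
  have hpiece (j : ℕ) : Monotone fun n => (σ n).piece j :=
    monotone_nat_of_le_succ fun n => (hs n).piece_subset j
  let A (l : List Bool) : Set X := (σ l.length).nhd l
  have hanti : CantorScheme.ClosureAntitone A := fun l b => (hs l.length).closure_nhd l rfl b
  have hdisj : CantorScheme.Disjoint A := by
    rintro l (_ | _) (_ | _) hb
    exacts [(hb rfl).elim, (hs l.length).disjoint_nhd l rfl,
      ((hs l.length).disjoint_nhd l rfl).symm, (hb rfl).elim]
  have hdiam : CantorScheme.VanishingDiam A := fun y => by
    refine (Filter.tendsto_add_atTop_iff_nat 1).1 (tendsto_of_tendsto_of_tendsto_of_le_of_le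
      tendsto_const_nhds (ENNReal.tendsto_pow_atTop_nhds_zero_of_lt_one (r := 2⁻¹) (by simp))
      (fun _ => zero_le) fun n => ?_)
    have hl := PiNat.res_length y n
    simpa [A, hl] using (hs n).ediam_nhd _ hl (y n)
  have hdom := hanti.map_of_vanishingDiam hdiam
    fun l => ⟨_, (hv l.length).pt_mem_nhd l rfl⟩
  have hmem_dom (y : ℕ → Bool) : y ∈ (CantorScheme.inducedMap A).1 := hdom ▸ mem_univ y
  let c (y : ℕ → Bool) : X := (CantorScheme.inducedMap A).2 ⟨y, hmem_dom y⟩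
  have hcA (y : ℕ → Bool) (n : ℕ) : c y ∈ A (PiNat.res y n) := CantorScheme.map_mem ⟨y, _⟩ n
  have hc : Continuous c := hdiam.map_continuous.comp (continuous_id.subtype_mk hmem_dom)
  have hinj : Function.Injective c := fun y z h => congrArg Subtype.val (hdisj.map_injective h)
  have hQ {y : ℕ → Bool} (hy : y ∈ eventuallyZero) : f (c y) ∈ ⋃ n, (σ n).val := by
    obtain ⟨N, hN⟩ := Filter.eventually_atTop.1 hy
    have hpt (n : ℕ) (hn : N ≤ n) :
        (σ n).pt (PiNat.res y n) = (σ N).pt (PiNat.res y N) := by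
      induction n, hn using Nat.le_induction with
      | base => rfl
      | succ n hn ih =>
        rw [PiNat.res_succ, hN n hn, (hs n).pt_false _ (PiNat.res_length y n), ih]
    have hcN : c y = (σ N).pt (PiNat.res y N) := by
      refine eq_of_forall_dist_le fun ε hε => ?_
      obtain ⟨n, hn⟩ := hdiam.dist_lt ε hε y
      have hle : A (PiNat.res y (max n N)) ⊆ A (PiNat.res y n) :=
        antitone_nat_of_succ_le (f := fun n => A (PiNat.res y n))
          (fun k => hanti.antitone (PiNat.res y k) (y k)) (le_max_left n N)
      refine (hn _ (hcA y n) _ (hle ?_)).le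
      rw [← hpt _ (le_max_right n N)]
      have hl := PiNat.res_length y (max n N)
      simpa only [A, hl] using (hv _).pt_mem_nhd _ hl
    exact mem_iUnion.2 ⟨N, hcN ▸ (hv N).apply_pt_mem _ (PiNat.res_length y N)⟩
  have hnQ {y : ℕ → Bool} (hy : y ∉ eventuallyZero) (N : ℕ) :
      ∃ n ≥ N, c y ∈ P n \ (σ n).piece n := by
    obtain ⟨n, hn, hyn⟩ := Filter.frequently_atTop.1 (Filter.not_eventually.1 hy) N
    refine ⟨n, hn, ?_⟩
    have hl := PiNat.res_length y n
    have hcn := hcA y (n + 1)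
    rw [PiNat.res_succ, Bool.eq_true_of_not_eq_false hyn] at hcn
    simp only [A, List.length_cons, hl] at hcn
    exact (hs n).nhd_true _ hl hcn
  have hout {y : ℕ → Bool} (hy : y ∉ eventuallyZero) : f (c y) ∉ ⋃ n, (σ n).val := by
    intro h
    obtain ⟨i, hi⟩ := mem_iUnion.1 h
    have hi' : c y ∈ f ⁻¹' (σ i).val := hi
    rw [(hv i).preimage_val] at hi'
    obtain ⟨j, hj⟩ := mem_iUnion.1 hi'
    obtain ⟨n, hn, -, hcn⟩ := hnQ hy (max i j)
    exact hcn (hpiece n ((le_max_left i j).trans hn)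
      ((hv i).monotone_piece ((le_max_right i j).trans hn) hj))
  refine ⟨⋃ n, (σ n).val, c, isOpen_iUnion fun n => (hv n).isClopen_val.isOpen,
    (hc.isClosedEmbedding hinj).isEmbedding, isCompact_range hc, ?_, ?_⟩
  · refine Subset.antisymm ?_ ?_
    · rintro _ ⟨hU, y, rfl⟩
      exact mem_image_of_mem c (by_contra fun hy => hout hy hU)
    · rintro _ ⟨y, hy, rfl⟩
      exact ⟨hQ hy, mem_range_self y⟩
  · rintro _ ⟨⟨y, rfl⟩, hy⟩
    rw [hOG]
    refine mem_iInter.2 fun m => ?_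
    obtain ⟨n, hn, hcn, -⟩ := hnQ (fun h => hy (mem_image_of_mem c h)) m
    exact mem_iInter₂.1 hcn m hn
end

section
/- Let X be a Polish space and let f : X → ω^ω be a function of Baire class 1 (the preimage under f of every open set is Fσ). For every Borel set B ⊆ X with B ∉ I^f there exist a Gδ set G ⊆ B with G ∉ I^f and a homeomorphism b from ω^ω onto G (with its subspace topology) such that for every S ⊆ G: S ∈ I^f if and only if b⁻¹[S] is contained in a countable union of compact subsets of ω^ω. -/
open Set

open Topology Filter

section Ideal

variable {X : Type*} [TopologicalSpace X] {f : X → (ℕ → ℕ)}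

theorem contIdeal_mono_s16 {A A' : Set X} (hA : A ∈ contIdeal f) (h : A' ⊆ A) :
    A' ∈ contIdeal f := by
  obtain ⟨C, hC, hAC⟩ := hA
  exact ⟨C, hC, h.trans hAC⟩

theorem contIdeal_of_closed {C : Set X} (hC : IsClosed C) (hf : ContinuousOn f C) :
    C ∈ contIdeal f :=
  ⟨fun _ => C, fun _ => ⟨hC, hf⟩, fun _ hx => mem_iUnion.2 ⟨0, hx⟩⟩

theorem contIdeal_empty : (∅ : Set X) ∈ contIdeal f :=
  contIdeal_of_closed isClosed_empty (continuousOn_empty f)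

theorem contIdeal_iUnion {A : ℕ → Set X} (hA : ∀ n, A n ∈ contIdeal f) :
    ⋃ n, A n ∈ contIdeal f := by
  choose C hC hAC using hA
  refine ⟨fun n => C n.unpair.1 n.unpair.2, fun n => hC _ _, iUnion_subset fun n x hx => ?_⟩
  obtain ⟨m, hm⟩ := mem_iUnion.1 (hAC n hx)
  exact mem_iUnion.2 ⟨Nat.pair n m, by simpa using hm⟩

theorem contIdeal_union {A A' : Set X} (hA : A ∈ contIdeal f) (hA' : A' ∈ contIdeal f) :
    A ∪ A' ∈ contIdeal f := by
  refine contIdeal_mono_s16 (contIdeal_iUnion (A := fun n => if n = 0 then A else A') ?_) ?_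
  · intro n
    split_ifs <;> assumption
  · rintro x (hx | hx)
    · exact mem_iUnion.2 ⟨0, by simpa using hx⟩
    · exact mem_iUnion.2 ⟨1, by simpa using hx⟩

theorem contIdeal_sUnion {T : Set (Set X)} (hT : T.Countable) (h : ∀ A ∈ T, A ∈ contIdeal f) :
    ⋃₀ T ∈ contIdeal f := by
  rcases T.eq_empty_or_nonempty with rfl | hne
  · simpa using contIdeal_empty
  · obtain ⟨A, rfl⟩ := hT.exists_eq_range hne
    rw [sUnion_range]
    exact contIdeal_iUnion fun n => h _ (mem_range_self n)

/-- If `f` has a limit along `A` equal to its own value at every point of the closure of `A`,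
then `A` lies in the ideal. -/
theorem contIdeal_of_tendsto {A : Set X}
    (h : ∀ x ∈ closure A, Tendsto f (𝓝[A] x) (𝓝 (f x))) : A ∈ contIdeal f := by
  refine contIdeal_mono_s16 (contIdeal_of_closed isClosed_closure ?_) subset_closure
  exact (continuousOn_extendFrom subset_rfl fun x hx => ⟨_, h x hx⟩).congr
    fun x hx => (extendFrom_eq hx (h x hx)).symm

/-- The image of a continuous map `h` outside the ideal is, after restriction to a closed set,
nowhere locally in the ideal. -/
theorem exists_isClosed_locally_notMem_contIdeal {P : Type*} [TopologicalSpace P]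
    [SecondCountableTopology P] (h : P → X) (hpos : range h ∉ contIdeal f) :
    ∃ Q : Set P, IsClosed Q ∧ Q.Nonempty ∧
      ∀ U : Set P, IsOpen U → (U ∩ Q).Nonempty → h '' (U ∩ Q) ∉ contIdeal f := by
  set 𝒰 : Set (Set P) := {U | IsOpen U ∧ h '' U ∈ contIdeal f}
  have hO : IsOpen (⋃₀ 𝒰) := isOpen_sUnion fun U hU => hU.1
  have hI : h '' (⋃₀ 𝒰) ∈ contIdeal f := by
    obtain ⟨T, hTc, hT, hTU⟩ := TopologicalSpace.isOpen_sUnion_countable 𝒰 fun U hU => hU.1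
    rw [← hTU, sUnion_eq_biUnion, image_iUnion₂, ← sUnion_image]
    refine contIdeal_sUnion (hTc.image _) ?_
    rintro _ ⟨U, hU, rfl⟩
    exact (hT hU).2
  refine ⟨(⋃₀ 𝒰)ᶜ, hO.isClosed_compl, ?_, ?_⟩
  · rw [nonempty_compl]
    intro hu
    rw [hu, image_univ] at hI
    exact hpos hI
  · rintro U hU ⟨p, hpU, hpQ⟩ hmem
    refine hpQ ⟨U, ⟨hU, contIdeal_mono_s16 (contIdeal_union hmem hI) ?_⟩, hpU⟩
    rintro _ ⟨q, hq, rfl⟩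
    by_cases hq' : q ∈ ⋃₀ 𝒰
    · exact Or.inr ⟨q, hq', rfl⟩
    · exact Or.inl ⟨q, ⟨hq, hq'⟩, rfl⟩

end Ideal

theorem exists_continuous_param {X : Type*} [TopologicalSpace X] [PolishSpace X]
    [MeasurableSpace X] [BorelSpace X] {f : X → (ℕ → ℕ)} (hf : Measurable f)
    {B : Set X} (hB : MeasurableSet B) (hne : B.Nonempty) :
    ∃ h : (ℕ → ℕ) → X, Continuous h ∧ Continuous (f ∘ h) ∧ range h = B := by
  have hS : MeasurableSet {p : X × (ℕ → ℕ) | p.1 ∈ B ∧ f p.1 = p.2} :=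
    (measurable_fst hB).inter (measurableSet_eq_fun (hf.comp measurable_fst) measurable_snd)
  have hA := hS.analyticSet
  rw [MeasureTheory.AnalyticSet] at hA
  obtain hA | ⟨g, hg, hgr⟩ := hA
  · obtain ⟨x, hx⟩ := hne
    have : (x, f x) ∈ {p : X × (ℕ → ℕ) | p.1 ∈ B ∧ f p.1 = p.2} := ⟨hx, rfl⟩
    rw [hA] at this
    exact this.elim
  · have hmem : ∀ y, (g y).1 ∈ B ∧ f (g y).1 = (g y).2 := fun y => by
      have : g y ∈ range g := mem_range_self y
      rwa [hgr] at this
    refine ⟨fun y => (g y).1, hg.fst, ?_, ?_⟩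
    · exact hg.snd.congr fun y => (hmem y).2.symm
    · refine Subset.antisymm (range_subset_iff.2 fun y => (hmem y).1) fun x hx => ?_
      have : (x, f x) ∈ range g := by rw [hgr]; exact ⟨hx, rfl⟩
      obtain ⟨y, hy⟩ := this
      exact ⟨y, by simp [hy]⟩

/-- A nonempty open set of parameters together with an open set containing its image. -/
structure OpenPair {Q X : Type*} [TopologicalSpace Q] [TopologicalSpace X] (h : Q → X) where
  dom : Set Q
  cod : Set X
  isOpen_dom : IsOpen dom
  nonempty_dom : dom.Nonempty
  isOpen_cod : IsOpen cod
  mapsTo : MapsTo h dom cod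

section Construction

variable {Q X : Type*} [MetricSpace Q] [MetricSpace X] {h : Q → X} {f : X → (ℕ → ℕ)}

/-- The open pairs `c n` are subpairs of `N`, are pairwise disjoint and converge to `x`, while `f`
stays away from `f x` on them. -/
structure IsFan (f : X → (ℕ → ℕ)) (N : OpenPair h) (ε : ℝ) (x : X) (V : Set (ℕ → ℕ))
    (c : ℕ → OpenPair h) : Prop where
  nhds : V ∈ 𝓝 (f x)
  closure_dom : ∀ n, closure (c n).dom ⊆ N.dom
  ediam_dom : ∀ n, Metric.ediam (c n).dom ≤ ENNReal.ofReal ε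
  cod_subset : ∀ n, (c n).cod ⊆ N.cod
  dist_lt : ∀ n, ∀ w ∈ (c n).cod, dist w x < ε * (1 / 2) ^ n
  disjoint : Pairwise fun m n => Disjoint (c m).cod (c n).cod
  notMem : ∀ n, ∀ q ∈ (c n).dom, f (h q) ∉ V

theorem exists_isFan (hh : Continuous h) (hfh : Continuous (f ∘ h))
    (hpos : ∀ U : Set Q, IsOpen U → U.Nonempty → h '' U ∉ contIdeal f)
    (N : OpenPair h) {ε : ℝ} (hε : 0 < ε) : ∃ x V c, IsFan f N ε x V c := by
  have hN := mt contIdeal_of_tendsto (hpos N.dom N.isOpen_dom N.nonempty_dom)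
  push Not at hN
  obtain ⟨x, -, hx⟩ := hN
  rw [(closed_nhds_basis (f x)).tendsto_right_iff] at hx
  push Not at hx
  obtain ⟨V, ⟨hV, hVc⟩, hx⟩ := hx
  have hz : ∀ δ : {δ : ℝ // 0 < δ}, ∃ q ∈ N.dom, dist (h q) x < δ ∧ f (h q) ∉ V := by
    intro δ
    have h1 : ∀ᶠ z in 𝓝[h '' N.dom] x, z ∈ h '' N.dom ∧ dist z x < δ :=
      (eventually_mem_nhdsWithin).and (nhdsWithin_le_nhds (Metric.ball_mem_nhds x δ.2))
    obtain ⟨_, hzV, ⟨q, hq, rfl⟩, hqx⟩ := (hx.and_eventually h1).exists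
    exact ⟨q, hq, hqx, hzV⟩
  choose q hqU hqx hqV using hz
  have hpos' : ∀ δ, 0 < dist (h (q δ)) x := fun δ => by
    rw [dist_pos]
    intro he
    exact hqV δ (he ▸ mem_of_mem_nhds hV)
  let δ : ℕ → {δ : ℝ // 0 < δ} := fun n =>
    Nat.rec ⟨ε, hε⟩ (fun _ d => ⟨dist (h (q d)) x / 2, half_pos (hpos' d)⟩) n
  have hδ : ∀ n, (δ (n + 1)).1 = dist (h (q (δ n))) x / 2 := fun n => rfl
  have hδlt : ∀ n : ℕ, (δ (n + 1)).1 < (δ n).1 / 2 := fun n => by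
    rw [hδ]
    linarith [hqx (δ n)]
  have hδanti : Antitone fun n => (δ n).1 :=
    antitone_nat_of_succ_le fun n => by linarith [hδlt n, (δ n).2]
  have hδle : ∀ n, (δ n).1 ≤ ε * (1 / 2) ^ n := by
    intro n
    induction n with
    | zero => simp [δ]
    | succ n ih => rw [pow_succ]; linarith [hδlt n]
  let W : ℕ → Set X := fun n => N.cod ∩ {w | (δ (n + 1)).1 < dist w x ∧ dist w x < (δ n).1}
  have hW : ∀ n, IsOpen (W n) := fun n =>
    N.isOpen_cod.inter ((isOpen_lt continuous_const (continuous_id.dist continuous_const)).inter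
      (isOpen_lt (continuous_id.dist continuous_const) continuous_const))
  have hball : ∀ n, ∃ r, 0 < r ∧ r ≤ ε / 2 ∧
      Metric.closedBall (q (δ n)) r ⊆ N.dom ∩ h ⁻¹' W n ∩ (f ∘ h) ⁻¹' Vᶜ := by
    intro n
    have ho : IsOpen (N.dom ∩ h ⁻¹' W n ∩ (f ∘ h) ⁻¹' Vᶜ) :=
      (N.isOpen_dom.inter ((hW n).preimage hh)).inter (hVc.isOpen_compl.preimage hfh)
    have hm : q (δ n) ∈ N.dom ∩ h ⁻¹' W n ∩ (f ∘ h) ⁻¹' Vᶜ := by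
      refine ⟨⟨hqU _, N.mapsTo (hqU _), ?_, hqx _⟩, hqV _⟩
      rw [hδ]
      exact half_lt_self (hpos' _)
    obtain ⟨r, hr, hrs⟩ := Metric.nhds_basis_closedBall.mem_iff.1 (ho.mem_nhds hm)
    exact ⟨min r (ε / 2), lt_min hr (half_pos hε), min_le_right _ _,
      (Metric.closedBall_subset_closedBall (min_le_left _ _)).trans hrs⟩
  choose r hr hrε hrs using hball
  refine ⟨x, V, fun n => ⟨Metric.ball (q (δ n)) (r n), W n, Metric.isOpen_ball,
    ⟨_, Metric.mem_ball_self (hr n)⟩, hW n,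
    fun p hp => (hrs n (Metric.ball_subset_closedBall hp)).1.2⟩, hV, ?_, ?_, ?_, ?_, ?_, ?_⟩
  · exact fun n => Metric.closure_ball_subset_closedBall.trans
      ((hrs n).trans fun p hp => hp.1.1)
  · intro n
    refine Metric.ediam_le fun a ha b hb => ?_
    rw [edist_dist]
    refine ENNReal.ofReal_le_ofReal ?_
    have := dist_triangle_right a b (q (δ n))
    linarith [Metric.mem_ball.1 ha, Metric.mem_ball.1 hb, hrε n]
  · exact fun n => inter_subset_left
  · exact fun n w hw => hw.2.2.trans_le (hδle n)
  · refine (pairwise_disjoint_on W).2 fun m n hmn => disjoint_left.2 fun w hwm hwn => ?_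
    have h1 := hδanti (Nat.succ_le_of_lt hmn)
    have h2 := hwm.2.1
    have h3 := hwn.2.2
    dsimp only at h1
    exact absurd (h2.trans (h3.trans_le h1)) (lt_irrefl _)
  · exact fun n p hp => (hrs n (Metric.ball_subset_closedBall hp)).2

/-- A tree of open pairs whose children form fans. -/
theorem exists_openPair_tree (hh : Continuous h) (hfh : Continuous (f ∘ h)) [Nonempty Q]
    (hpos : ∀ U : Set Q, IsOpen U → U.Nonempty → h '' U ∉ contIdeal f) :
    ∃ (T : List ℕ → OpenPair h) (x : List ℕ → X) (V : List ℕ → Set (ℕ → ℕ)),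
      ∀ l, IsFan f (T l) ((1 / 2) ^ l.length) (x l) (V l) fun n => T (n :: l) := by
  choose x V c hc using fun (N : OpenPair h) (k : ℕ) =>
    exists_isFan hh hfh hpos N (ε := (1 / 2) ^ k) (by positivity)
  let root : OpenPair h :=
    ⟨univ, univ, isOpen_univ, univ_nonempty, isOpen_univ, mapsTo_univ _ _⟩
  let T : List ℕ → OpenPair h := fun l => List.rec root (fun n t N => c N t.length n) l
  exact ⟨T, fun l => x (T l) l.length, fun l => V (T l) l.length, fun l => hc (T l) l.length⟩

end Construction

section Scheme

variable {X : Type*} [MetricSpace X]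

/-- Points trapped in a disjoint vanishing open scheme give an embedding with `Gδ` range. -/
theorem isEmbedding_of_scheme {W : List ℕ → Set X} (hW : ∀ l, IsOpen (W l))
    (hanti : CantorScheme.Antitone W) (hdisj : CantorScheme.Disjoint W)
    (hvan : CantorScheme.VanishingDiam W) {b : (ℕ → ℕ) → X}
    (hb : ∀ y n, b y ∈ W (PiNat.res y n)) : IsEmbedding b ∧ IsGδ (range b) := by
  have hres : ∀ n (y z : ℕ → ℕ) (w : X), w ∈ W (PiNat.res y n) → w ∈ W (PiNat.res z n) →
      PiNat.res y n = PiNat.res z n := by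
    intro n y z w
    induction n with
    | zero => intros; rfl
    | succ n ih =>
      intro h1 h2
      rw [PiNat.res_succ] at h1 h2
      have he := ih (hanti _ _ h1) (hanti _ _ h2)
      rw [PiNat.res_succ, PiNat.res_succ, he]
      rw [he] at h1
      by_cases hyz : y n = z n
      · rw [hyz]
      · exact (disjoint_left.1 (hdisj (PiNat.res z n) hyz) h1 h2).elim
  have hcyl : ∀ (y : ℕ → ℕ) n, ∀ᶠ z in 𝓝 y, PiNat.res z n = PiNat.res y n := by
    intro y n
    have := (PiNat.isOpen_cylinder (fun _ : ℕ => ℕ) y n).mem_nhds (PiNat.self_mem_cylinder y n)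
    rw [PiNat.cylinder_eq_res] at this
    exact this
  have hcont : Continuous b := by
    rw [Metric.continuous_iff']
    intro y ε hε
    obtain ⟨n, hn⟩ := hvan.dist_lt ε hε y
    filter_upwards [hcyl y n] with z hz
    exact hn _ (hz ▸ hb z n) _ (hb y n)
  have hinj : Function.Injective b := fun y z hyz =>
    PiNat.res_injective (funext fun n => hres n y z (b y) (hb y n) (hyz ▸ hb z n))
  refine ⟨⟨isInducing_iff_nhds.2 fun y => le_antisymm (hcont.tendsto y).le_comap ?_, hinj⟩, ?_⟩
  · intro s hs
    obtain ⟨n, hn⟩ : ∃ n, PiNat.cylinder y n ⊆ s := by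
      obtain ⟨_, ⟨z, n, rfl⟩, hy, hs'⟩ :=
        (PiNat.isTopologicalBasis_cylinders (fun _ : ℕ => ℕ)).mem_nhds_iff.1 hs
      exact ⟨n, (PiNat.mem_cylinder_iff_eq.1 hy).symm ▸ hs'⟩
    refine mem_comap.2 ⟨W (PiNat.res y n), (hW _).mem_nhds (hb y n), fun z hz => hn ?_⟩
    rw [PiNat.cylinder_eq_res]
    exact hres n z y (b z) (hb z n) hz
  · have : range b = ⋂ n, ⋃ y : ℕ → ℕ, W (PiNat.res y n) := by
      refine Subset.antisymm ?_ fun w hw => ?_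
      · rintro _ ⟨y, rfl⟩
        exact mem_iInter.2 fun n => mem_iUnion.2 ⟨y, hb y n⟩
      · choose y hy using fun n => mem_iUnion.1 (mem_iInter.1 hw n)
        have hle : ∀ n, w ∈ W (PiNat.res (fun k => y (k + 1) k) n) := by
          intro n
          induction n with
          | zero => exact hy 0
          | succ n ih =>
            have h1 := hy (n + 1)
            have h2 := hres n _ _ w (hanti _ _ h1) ih
            rw [PiNat.res_succ] at h1 ⊢
            rwa [h2] at h1
        refine ⟨fun k => y (k + 1) k, dist_le_zero.1 (le_of_forall_pos_le_add fun ε hε => ?_)⟩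
        obtain ⟨n, hn⟩ := hvan.dist_lt ε hε fun k => y (k + 1) k
        rw [zero_add]
        exact (hn _ (hb _ n) _ (hle n)).le
    rw [this]
    exact IsGδ.iInter_of_isOpen fun n => isOpen_iUnion fun y => hW _

end Scheme

/-- A subset of the Baire space in which every node of the generated tree has finitely many
immediate successors is contained in a compact set. -/
theorem exists_isCompact_of_finite_branching {D : Set (ℕ → ℕ)}
    (hD : ∀ l : List ℕ, {n | ∃ y ∈ D, PiNat.res y (l.length + 1) = n :: l}.Finite) :
    ∃ K : Set (ℕ → ℕ), IsCompact K ∧ D ⊆ K := by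
  have hfin : ∀ k, ((fun y => PiNat.res y k) '' D).Finite := by
    intro k
    induction k with
    | zero => exact (finite_singleton []).subset (by rintro _ ⟨y, -, rfl⟩; rfl)
    | succ k ih =>
      refine (ih.biUnion fun l _ => (hD l).image fun n => n :: l).subset ?_
      rintro _ ⟨y, hy, rfl⟩
      refine mem_biUnion (mem_image_of_mem _ hy) ⟨y k, ⟨y, hy, ?_⟩, rfl⟩
      simp
  refine ⟨univ.pi fun k => (fun y : ℕ → ℕ => y k) '' D, isCompact_univ_pi fun k => ?_,
    fun y hy k _ => ⟨y, hy, rfl⟩⟩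
  refine (((hfin (k + 1)).image fun l => l.headI).subset ?_).isCompact
  rintro _ ⟨y, hy, rfl⟩
  exact ⟨_, ⟨y, hy, rfl⟩, by simp⟩

theorem not_sigmaCompact_baire (K : ℕ → Set (ℕ → ℕ)) (hK : ∀ n, IsCompact (K n)) :
    ¬ univ ⊆ ⋃ n, K n := by
  intro hu
  have hb : ∀ n, BddAbove ((fun y : ℕ → ℕ => y n) '' K n) := fun n =>
    ((hK n).image (continuous_apply n)).bddAbove
  choose M hM using hb
  obtain ⟨n, hn⟩ := mem_iUnion.1 (hu (mem_univ fun n => M n + 1))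
  have := hM n ⟨_, hn, rfl⟩
  simp at this

theorem exists_embedding_of_locally_notMem {Q X : Type*} [MetricSpace Q] [CompleteSpace Q]
    [Nonempty Q] [MetricSpace X] {h : Q → X} {f : X → (ℕ → ℕ)}
    (hh : Continuous h) (hfh : Continuous (f ∘ h))
    (hpos : ∀ U : Set Q, IsOpen U → U.Nonempty → h '' U ∉ contIdeal f) :
    ∃ b : (ℕ → ℕ) → X, IsEmbedding b ∧ IsGδ (range b) ∧ range b ⊆ range h ∧
      Continuous (f ∘ b) ∧ ∀ C : Set X, IsClosed C → ContinuousOn f C →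
        ∃ K, IsCompact K ∧ b ⁻¹' C ⊆ K := by
  obtain ⟨T, x, V, hT⟩ := exists_openPair_tree hh hfh hpos
  let A : List ℕ → Set Q := fun l => (T l).dom
  let W : List ℕ → Set X := fun l => (T l).cod
  have htend : Tendsto (fun n : ℕ => ENNReal.ofReal ((1 / 2) ^ n)) atTop (𝓝 0) := by
    rw [← ENNReal.ofReal_zero]
    exact ENNReal.tendsto_ofReal
      (tendsto_pow_atTop_nhds_zero_of_lt_one (by norm_num) (by norm_num))
  have hAvan : CantorScheme.VanishingDiam A := by
    intro y
    rw [← tendsto_add_atTop_iff_nat 1]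
    refine tendsto_of_tendsto_of_tendsto_of_le_of_le tendsto_const_nhds htend
      (fun _ => zero_le) fun n => ?_
    simpa using (hT (PiNat.res y n)).ediam_dom (y n)
  have hWvan : CantorScheme.VanishingDiam W := by
    intro y
    rw [← tendsto_add_atTop_iff_nat 2]
    refine tendsto_of_tendsto_of_tendsto_of_le_of_le tendsto_const_nhds htend
      (fun _ => zero_le) fun n => ?_
    refine Metric.ediam_le fun a ha b hb => ?_
    rw [edist_dist]
    refine ENNReal.ofReal_le_ofReal ?_
    have hd : ∀ w ∈ W (PiNat.res y (n + 2)),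
        dist w (x (PiNat.res y (n + 1))) < (1 / 2) ^ (n + 1) := fun w hw => by
      refine ((hT (PiNat.res y (n + 1))).dist_lt (y (n + 1)) w hw).trans_le ?_
      rw [PiNat.res_length]
      exact mul_le_of_le_one_right (by positivity) (pow_le_one₀ (by norm_num) (by norm_num))
    have h1 := hd a ha
    have h2 := hd b hb
    have := dist_triangle_right a b (x (PiNat.res y (n + 1)))
    rw [pow_succ] at h1 h2
    linarith
  have hAanti : CantorScheme.ClosureAntitone A := fun l n => (hT l).closure_dom n
  have hdom : (CantorScheme.inducedMap A).1 = univ :=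
    hAanti.map_of_vanishingDiam hAvan fun l => (T l).nonempty_dom
  let p : (ℕ → ℕ) → Q := fun y => (CantorScheme.inducedMap A).2 ⟨y, hdom ▸ mem_univ y⟩
  have hp : Continuous p :=
    hAvan.map_continuous.comp (continuous_id.subtype_mk fun y => hdom ▸ mem_univ y)
  have hpA : ∀ y n, p y ∈ (T (PiNat.res y n)).dom := fun y n =>
    CantorScheme.map_mem (A := A) ⟨y, hdom ▸ mem_univ y⟩ n
  have hbW : ∀ y n, h (p y) ∈ W (PiNat.res y n) := fun y n => (T _).mapsTo (hpA y n)
  obtain ⟨hemb, hGδ⟩ := isEmbedding_of_scheme (W := W) (b := h ∘ p) (fun l => (T l).isOpen_cod)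
    (fun l n => (hT l).cod_subset n) (fun l => (hT l).disjoint) hWvan hbW
  refine ⟨h ∘ p, hemb, hGδ, range_comp_subset_range p h, hfh.comp hp, fun C hC hfC => ?_⟩
  refine exists_isCompact_of_finite_branching fun l => ?_
  by_contra hinf
  have hfreq : ∀ N ∈ 𝓝 (x l), ∃ w ∈ N ∩ C, f w ∉ V l := by
    intro N hN
    obtain ⟨ε, hε, hεN⟩ := Metric.mem_nhds_iff.1 hN
    have hlim : Tendsto (fun n : ℕ => ((1 : ℝ) / 2) ^ l.length * (1 / 2) ^ n) atTop (𝓝 0) := by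
      simpa using (tendsto_pow_atTop_nhds_zero_of_lt_one (r := (1 : ℝ) / 2)
        (by norm_num) (by norm_num)).const_mul (((1 : ℝ) / 2) ^ l.length)
    obtain ⟨n, ⟨y, hyC, hyn⟩, hn⟩ :=
      ((Nat.frequently_atTop_iff_infinite.2 hinf).and_eventually
        (hlim.eventually (gt_mem_nhds hε))).exists
    have h1 := hpA y (l.length + 1)
    rw [hyn] at h1
    exact ⟨h (p y), ⟨hεN (((hT l).dist_lt n _ ((T _).mapsTo h1)).trans hn), hyC⟩,
      (hT l).notMem n _ h1⟩
  have hxC : x l ∈ C := by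
    rw [← hC.closure_eq, mem_closure_iff_nhds]
    exact fun N hN => (hfreq N hN).imp fun w hw => hw.1
  obtain ⟨N, hN, hNV⟩ := mem_nhdsWithin_iff_exists_mem_nhds_inter.1 (hfC _ hxC (hT l).nhds)
  obtain ⟨w, hw, hwV⟩ := hfreq N hN
  exact hwV (hNV hw)

theorem positive_borel_contains_baire_copy_with_Ksigma_ideal
    {X : Type*} [TopologicalSpace X] [PolishSpace X]
    [MeasurableSpace X] [BorelSpace X]
    (f : X → (ℕ → ℕ)) (hf : BaireClassOne f)
    (B : Set X) (hB : MeasurableSet B) (hBpos : B ∉ contIdeal f) :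
    ∃ G : Set X, G ⊆ B ∧ IsGδ G ∧ G ∉ contIdeal f ∧
      ∃ b : (ℕ → ℕ) → X, Topology.IsEmbedding b ∧ Set.range b = G ∧
        ∀ S : Set X, S ⊆ G →
          (S ∈ contIdeal f ↔
            ∃ K : ℕ → Set (ℕ → ℕ), (∀ n, IsCompact (K n)) ∧ b ⁻¹' S ⊆ ⋃ n, K n) := by
  have hfm : Measurable f := measurable_of_isOpen fun U hU => by
    obtain ⟨F, hF, hFU⟩ := hf U hU
    rw [hFU]
    exact .iUnion fun n => (hF n).measurableSet
  have hne : B.Nonempty := nonempty_iff_ne_empty.2 fun h => hBpos (h ▸ contIdeal_empty)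
  obtain ⟨h, hh, hfh, rfl⟩ := exists_continuous_param hfm hB hne
  obtain ⟨Q, hQ, hQne, hQpos⟩ := exists_isClosed_locally_notMem_contIdeal h hBpos
  have := hQ.polishSpace
  have := hQne.to_subtype
  let _ := TopologicalSpace.upgradeIsCompletelyMetrizable Q
  let _ := TopologicalSpace.upgradeIsCompletelyMetrizable X
  obtain ⟨b, hb, hGδ, hbr, hfb, hC⟩ := exists_embedding_of_locally_notMem (Q := Q)
    (h := fun q => h q) (f := f) (hh.comp continuous_subtype_val)
    (hfh.comp continuous_subtype_val) (by
      intro U hU hUne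
      obtain ⟨O, hO, rfl⟩ := isOpen_induced_iff.1 hU
      have himg : (fun q : Q => h q) '' (Subtype.val ⁻¹' O) = h '' (O ∩ Q) := by
        rw [inter_comm, ← Subtype.image_preimage_coe, image_image]
      rw [himg]
      obtain ⟨q, hq⟩ := hUne
      exact hQpos O hO ⟨q, hq, q.2⟩)
  have key : ∀ S ⊆ range b, (S ∈ contIdeal f ↔
      ∃ K : ℕ → Set (ℕ → ℕ), (∀ n, IsCompact (K n)) ∧ b ⁻¹' S ⊆ ⋃ n, K n) := by
    intro S hS
    constructor
    · rintro ⟨C, hCc, hSC⟩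
      choose K hK hCK using fun n => hC (C n) (hCc n).1 (hCc n).2
      refine ⟨K, hK, (preimage_mono hSC).trans ?_⟩
      rw [preimage_iUnion]
      exact iUnion_mono hCK
    · rintro ⟨K, hK, hSK⟩
      have hfr : ContinuousOn f (range b) := by
        rintro _ ⟨y, rfl⟩
        rw [ContinuousWithinAt, ← hb.map_nhds_eq]
        exact hfb.tendsto y
      refine ⟨fun n => b '' K n, fun n => ⟨((hK n).image hb.continuous).isClosed,
        hfr.mono (image_subset_range _ _)⟩, fun s hs => ?_⟩
      obtain ⟨y, rfl⟩ := hS hs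
      obtain ⟨n, hn⟩ := mem_iUnion.1 (hSK hs)
      exact mem_iUnion.2 ⟨n, y, hn, rfl⟩
  refine ⟨range b, hbr.trans ?_, hGδ, fun hG => ?_, b, hb, rfl, key⟩
  · rintro _ ⟨q, rfl⟩
    exact mem_range_self _
  · obtain ⟨K, hK, hKu⟩ := (key _ subset_rfl).1 hG
    rw [preimage_range] at hKu
    exact not_sigmaCompact_baire K hK hKu
end
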